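/- arXiv:2507.04796 — 6 statements merged into one kernel-verified Lean document; each statement's English description precedes it below -/
import Mathlib

section
/- Let V be a finite-dimensional real inner product space and let T : V → V be a self-adjoint linear operator. Then the inequality ⟨x, T y⟩² ≥ ⟨x, T x⟩ · ⟨y, T y⟩ holds for all x, y ∈ V with ⟨y, T y⟩ ≥ 0 if and only if the positive eigenspace of T, i.e. the subspace ⨆_{λ>0} ker(T − λ·id), has dimension at most one. -/
open scoped InnerProductSpace

/-- The span of the eigenspaces of `T` for positive eigenvalues. -/
abbrev positiveEigenspace {V : Type*} [NormedAddCommGroup V] [InnerProductSpace ℝ V]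
    (T : V →ₗ[ℝ] V) : Submodule ℝ V :=
  ⨆ (μ : ℝ) (_ : 0 < μ), Module.End.eigenspace T μ

section

variable {V : Type*} [NormedAddCommGroup V] [InnerProductSpace ℝ V] {T : V →ₗ[ℝ] V}

theorem LinearMap.IsSymmetric.inner_eq_zero_of_mem_positiveEigenspace (hT : T.IsSymmetric)
    {μ : ℝ} (hμ : μ ≤ 0) {v x : V} (hv : T v = μ • v) (hx : x ∈ positiveEigenspace T) :
    ⟪v, x⟫_ℝ = 0 := by
  have hle : positiveEigenspace T ≤ (ℝ ∙ v)ᗮ := by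
    refine iSup₂_le fun ν hν w hw => ?_
    rw [Submodule.mem_orthogonal_singleton_iff_inner_right]
    have h := hT v w
    rw [hv, Module.End.mem_eigenspace_iff.1 hw, real_inner_smul_left, real_inner_smul_right] at h
    have : (μ - ν) * ⟪v, w⟫_ℝ = 0 := by linarith
    exact (mul_eq_zero.1 this).resolve_left (by linarith)
  exact (Submodule.mem_orthogonal_singleton_iff_inner_right).1 (hle hx)

theorem LinearMap.IsSymmetric.inner_smul_sub_smul_apply_self (hT : T.IsSymmetric)
    (a b : ℝ) (x y : V) :
    ⟪a • x - b • y, T (a • x - b • y)⟫_ℝ =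
      a ^ 2 * ⟪x, T x⟫_ℝ - 2 * a * b * ⟪x, T y⟫_ℝ + b ^ 2 * ⟪y, T y⟫_ℝ := by
  have h : ⟪y, T x⟫_ℝ = ⟪x, T y⟫_ℝ := by rw [← hT, real_inner_comm]
  simp only [map_sub, map_smul, inner_sub_left, inner_sub_right, real_inner_smul_left,
    real_inner_smul_right, h]
  ring

variable [FiniteDimensional ℝ V]

theorem LinearMap.IsSymmetric.inner_apply_self_eq_sum (hT : T.IsSymmetric) (x : V) :
    ⟪x, T x⟫_ℝ = ∑ i, hT.eigenvalues rfl i * ⟪hT.eigenvectorBasis rfl i, x⟫_ℝ ^ 2 := by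
  rw [← (hT.eigenvectorBasis rfl).sum_inner_mul_inner x (T x)]
  refine Finset.sum_congr rfl fun i _ => ?_
  rw [← hT, hT.apply_eigenvectorBasis, real_inner_comm]
  simp only [RCLike.ofReal_real_eq_id, id_eq, real_inner_smul_left]
  ring

theorem LinearMap.IsSymmetric.inner_apply_self_nonpos_of_mem_orthogonal (hT : T.IsSymmetric)
    {x : V} (hx : x ∈ (positiveEigenspace T)ᗮ) : ⟪x, T x⟫_ℝ ≤ 0 := by
  rw [hT.inner_apply_self_eq_sum]
  refine Finset.sum_nonpos fun i _ => ?_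
  rcases le_or_gt (hT.eigenvalues rfl i) 0 with h | h
  · exact mul_nonpos_of_nonpos_of_nonneg h (sq_nonneg _)
  · have hmem : hT.eigenvectorBasis rfl i ∈ positiveEigenspace T :=
      Submodule.mem_iSup_of_mem _ <| Submodule.mem_iSup_of_mem h <|
        Module.End.mem_eigenspace_iff.2 (hT.apply_eigenvectorBasis rfl i)
    simp [Submodule.inner_right_of_mem_orthogonal hmem hx]

theorem LinearMap.IsSymmetric.inner_apply_self_pos_of_mem_positiveEigenspace
    (hT : T.IsSymmetric) {x : V} (hx : x ∈ positiveEigenspace T) (hx0 : x ≠ 0) :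
    0 < ⟪x, T x⟫_ℝ := by
  have hzero (i) (h : hT.eigenvalues rfl i ≤ 0) : ⟪hT.eigenvectorBasis rfl i, x⟫_ℝ = 0 :=
    hT.inner_eq_zero_of_mem_positiveEigenspace h (hT.apply_eigenvectorBasis rfl i) hx
  obtain ⟨i, hi⟩ : ∃ i, ⟪hT.eigenvectorBasis rfl i, x⟫_ℝ ≠ 0 := by
    by_contra! h
    exact hx0 (by rw [← (hT.eigenvectorBasis rfl).sum_repr' x]; simp [h])
  rw [hT.inner_apply_self_eq_sum]
  refine Finset.sum_pos' (fun j _ => ?_) ⟨i, Finset.mem_univ _, ?_⟩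
  · rcases le_or_gt (hT.eigenvalues rfl j) 0 with h | h
    · simp [hzero j h]
    · positivity
  · have : 0 < hT.eigenvalues rfl i := not_le.1 fun h => hi (hzero i h)
    positivity

end

/-- Shenfeld–van Handel spectral lemma: for a self-adjoint operator `T` on a
finite-dimensional real inner product space, the quadratic inequality
`⟪x, T y⟫² ≥ ⟪x, T x⟫ ⟪y, T y⟫` (for all `x, y` with `⟪y, T y⟫ ≥ 0`) holds
iff the positive eigenspace of `T` has dimension at most one. -/
theorem stmt0 {V : Type*} [NormedAddCommGroup V] [InnerProductSpace ℝ V]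
    [FiniteDimensional ℝ V] (T : V →ₗ[ℝ] V)
    (hT : ∀ x y : V, ⟪T x, y⟫_ℝ = ⟪x, T y⟫_ℝ) :
    (∀ x y : V, 0 ≤ ⟪y, T y⟫_ℝ →
      ⟪x, T x⟫_ℝ * ⟪y, T y⟫_ℝ ≤ ⟪x, T y⟫_ℝ ^ 2) ↔
    Module.finrank ℝ
      ↥(⨆ (μ : ℝ) (_ : 0 < μ), Module.End.eigenspace T μ) ≤ 1 := by
  have hS : T.IsSymmetric := hT
  constructor
  · intro H
    change Module.finrank ℝ (positiveEigenspace T) ≤ 1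
    rcases subsingleton_or_nontrivial (positiveEigenspace T) with h | h
    · simp [Module.finrank_zero_of_subsingleton]
    obtain ⟨⟨y, hy⟩, hy0⟩ := exists_ne (0 : positiveEigenspace T)
    have hQ : 0 < ⟪y, T y⟫_ℝ :=
      hS.inner_apply_self_pos_of_mem_positiveEigenspace hy (by simpa using hy0)
    refine finrank_le_one ⟨y, hy⟩ fun ⟨x, hx⟩ => ⟨⟪x, T y⟫_ℝ / ⟪y, T y⟫_ℝ, ?_⟩
    have hz : ⟪y, T y⟫_ℝ • x - ⟪x, T y⟫_ℝ • y = 0 := by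
      by_contra hne
      have hpos := hS.inner_apply_self_pos_of_mem_positiveEigenspace
        (sub_mem (Submodule.smul_mem _ _ hx) (Submodule.smul_mem _ _ hy)) hne
      rw [hS.inner_smul_sub_smul_apply_self] at hpos
      nlinarith [mul_le_mul_of_nonneg_left (H x y hQ.le) hQ.le]
    ext
    change (⟪x, T y⟫_ℝ / ⟪y, T y⟫_ℝ) • y = x
    rw [div_eq_inv_mul, mul_smul, ← sub_eq_zero.1 hz, inv_smul_smul₀ hQ.ne']
  · intro H x y hy
    rcases hy.eq_or_lt with h0 | hpos
    · rw [← h0, mul_zero]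
      positivity
    change Module.finrank ℝ (positiveEigenspace T) ≤ 1 at H
    obtain ⟨v, hv⟩ := ((Submodule.finrank_le_one_iff_isPrincipal _).1 H).principal
    have hvy : ⟪v, y⟫_ℝ ≠ 0 := fun h =>
      hpos.not_ge <| hS.inner_apply_self_nonpos_of_mem_orthogonal <| by
        rwa [hv, Submodule.mem_orthogonal_singleton_iff_inner_right]
    have hz := hS.inner_apply_self_nonpos_of_mem_orthogonal
      (x := ⟪v, y⟫_ℝ • x - ⟪v, x⟫_ℝ • y) <| by
        rw [hv, Submodule.mem_orthogonal_singleton_iff_inner_right, inner_sub_right,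
          real_inner_smul_right, real_inner_smul_right]
        ring
    rw [hS.inner_smul_sub_smul_apply_self] at hz
    refine le_of_mul_le_mul_left ?_ (pow_pos (abs_pos.2 hvy) 2)
    rw [sq_abs]
    nlinarith [mul_le_mul_of_nonneg_right hz hy,
      sq_nonneg (⟪v, y⟫_ℝ * ⟪x, T y⟫_ℝ - ⟪v, x⟫_ℝ * ⟪y, T y⟫_ℝ)]
end

section
/- If A₁, …, Aₙ are symmetric positive definite real n×n matrices, then the mixed discriminant is strictly positive: Q(A₁, …, Aₙ) > 0. -/
/-- The mixed discriminant of `n` real `n × n` matrices: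
`Q(A₁, …, Aₙ) = (1/n!) Σ_{σ,τ ∈ Sₙ} sgn σ · sgn τ · ∏ₖ (Aₖ)_{σ(k) τ(k)}`. -/
noncomputable def mixedDisc {n : ℕ} (A : Fin n → Matrix (Fin n) (Fin n) ℝ) : ℝ :=
  (n.factorial : ℝ)⁻¹ *
    ∑ σ : Equiv.Perm (Fin n), ∑ τ : Equiv.Perm (Fin n),
      ((Equiv.Perm.sign σ : ℤ) : ℝ) * ((Equiv.Perm.sign τ : ℤ) : ℝ) *
        ∏ k : Fin n, A k (σ k) (τ k)

open Matrix in
/-- The Leibniz formula with the rows, rather than the columns, permuted. -/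
theorem Matrix.det_eq_sum_sign_mul_prod_row {n R : Type*} [Fintype n] [DecidableEq n]
    [CommRing R] (M : Matrix n n R) :
    M.det = ∑ σ : Equiv.Perm n, ((Equiv.Perm.sign σ : ℤ) : R) * ∏ k, M k (σ k) := by
  rw [← det_transpose, det_apply']
  rfl

open Matrix in
/-- The mixed discriminant of Gram matrices `Bₖᵀ Bₖ` is, up to the factor `1/n!`, the sum of the
squared determinants of all matrices whose `k`-th row is taken from `Bₖ`. -/
theorem mixedDisc_transpose_mul_self {n : ℕ} (B : Fin n → Matrix (Fin n) (Fin n) ℝ) :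
    mixedDisc (fun k => (B k)ᵀ * B k) =
      (n.factorial : ℝ)⁻¹ * ∑ f : Fin n → Fin n, (det (of fun k => B k (f k))) ^ 2 := by
  unfold mixedDisc
  congr 1
  simp only [mul_apply, transpose_apply, Finset.prod_univ_sum, Fintype.piFinset_univ,
    Finset.prod_mul_distrib, det_eq_sum_sign_mul_prod_row, of_apply, sq, Finset.sum_mul_sum]
  simp only [Finset.mul_sum]
  conv_rhs =>
    rw [Finset.sum_comm]
    enter [2, σ]
    rw [Finset.sum_comm]
  refine Finset.sum_congr rfl fun σ _ => Finset.sum_congr rfl fun τ _ =>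
    Finset.sum_congr rfl fun f _ => ?_
  ring

open Matrix in
/-- From the rows of invertible matrices `Bₖ` one can pick an independent transversal. -/
theorem exists_det_row_ne_zero {n K : Type*} [Fintype n] [DecidableEq n] [Field K]
    (B : n → Matrix n n K) (hB : ∀ k, IsUnit (B k)) :
    ∃ f : n → n, det (of fun k => B k (f k)) ≠ 0 := by
  by_contra! h
  have hrow (k : n) : (1 : Matrix n n K) k = ∑ m, (B k)⁻¹ k m • B k m := by
    rw [← nonsing_inv_mul (B k) ((isUnit_iff_isUnit_det _).1 (hB k))]
    ext j
    simp [mul_apply]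
  have hdet : det (1 : Matrix n n K) = 0 := by
    change (detRowAlternating : (n → K) [⋀^n]→ₗ[K] K).toMultilinearMap
      (fun k => (1 : Matrix n n K) k) = 0
    simp_rw [hrow, MultilinearMap.map_sum, MultilinearMap.map_smul_univ]
    refine Finset.sum_eq_zero fun f _ => ?_
    exact smul_eq_zero_of_right _ (h f)
  exact one_ne_zero (det_one.symm.trans hdet)

open scoped MatrixOrder Matrix.Norms.L2Operator in
open Matrix in
/-- A positive definite real matrix is the Gram matrix of an invertible one. -/
theorem Matrix.PosDef.exists_isUnit_eq_transpose_mul_self {n : Type*} [Fintype n]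
    [DecidableEq n] {A : Matrix n n ℝ} (hA : A.PosDef) :
    ∃ B : Matrix n n ℝ, IsUnit B ∧ A = Bᵀ * B := by
  obtain ⟨B, hB, h⟩ :=
    CStarAlgebra.isStrictlyPositive_iff_eq_star_mul_self.mp hA.isStrictlyPositive
  exact ⟨B, hB, by rw [h, star_eq_conjTranspose, conjTranspose_eq_transpose_of_trivial]⟩

/-- The mixed discriminant of symmetric positive definite matrices is positive. -/
theorem stmt5 {n : ℕ} (A : Fin n → Matrix (Fin n) (Fin n) ℝ)
    (hA : ∀ k, (A k).PosDef) :
    0 < mixedDisc A := by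
  choose B hB hAB using fun k => (hA k).exists_isUnit_eq_transpose_mul_self
  obtain ⟨f, hf⟩ := exists_det_row_ne_zero B hB
  rw [funext hAB, mixedDisc_transpose_mul_self]
  refine mul_pos (by positivity) (Finset.sum_pos' (fun _ _ => sq_nonneg _) ?_)
  exact ⟨f, Finset.mem_univ f, by positivity⟩
end

section
/- Alexandrov's mixed discriminant inequality: let n ≥ 2, let A be a symmetric real n×n matrix, and let B, C₃, …, Cₙ be symmetric positive definite real n×n matrices. Then Q(A, B, C₃, …, Cₙ)² ≥ Q(A, A, C₃, …, Cₙ) · Q(B, B, C₃, …, Cₙ). -/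
/-- `Q(A, B, C₃, …, Cₙ)`: the mixed discriminant with first two slots `A`, `B`
and remaining slots given by `C`. -/
noncomputable def mixedDisc2 {n : ℕ} (A B : Matrix (Fin (n + 2)) (Fin (n + 2)) ℝ)
    (C : Fin (n + 2) → Matrix (Fin (n + 2)) (Fin (n + 2)) ℝ) : ℝ :=
  mixedDisc (fun k => if k = 0 then A else if k = 1 then B else C k)

open Polynomial in
/-- A complex polynomial without zeros in the closed upper half-plane, whose `d`-th coefficient
is nonzero for some `d ≥ 1`, has nonzero linear coefficient. -/
theorem coeff_one_ne_zero_of_forall_eval_ne_zero {p : ℂ[X]} {d : ℕ} (hd : d ≠ 0)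
    (hpd : p.coeff d ≠ 0) (hp : ∀ s : ℂ, 0 ≤ s.im → p.eval s ≠ 0) : p.coeff 1 ≠ 0 := by
  intro h
  have hdeg : 0 < p.degree :=
    lt_of_lt_of_le (by exact_mod_cast Nat.pos_of_ne_zero hd) (le_degree_of_ne_zero hpd)
  have hder : p.derivative ≠ 0 := fun h0 ↦ by
    rw [eq_C_of_derivative_eq_zero h0] at hdeg
    exact hdeg.not_ge degree_C_le
  have hroot : (0 : ℂ) ∈ p.derivative.rootSet ℂ := by
    rw [mem_rootSet, coe_aeval_eq_eval, ← coeff_zero_eq_eval_zero, coeff_derivative]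
    simpa [h] using hder
  have hsub : p.rootSet ℂ ⊆ {z : ℂ | z.im < 0} := fun z hz ↦ by
    rw [mem_rootSet, coe_aeval_eq_eval] at hz
    exact lt_of_not_ge fun hz' ↦ hp z hz' hz.2
  have h0 := convexHull_min hsub (convex_halfSpace_im_lt 0)
    (rootSet_derivative_subset_convexHull_rootSet hdeg hroot)
  simp at h0

namespace MultilinearMap

variable {ι M : Type*} [Fintype ι] [DecidableEq ι] [AddCommGroup M] [Module ℂ M]

open Polynomial in
/-- The polynomial `s ↦ f (X + s • V, …, X + s • V, Cᵢ, …)`, where the entries in `S` are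
those of `C`. -/
noncomputable def linePolynomial (f : MultilinearMap ℂ (fun _ : ι ↦ M) ℂ) (S : Finset ι)
    (C : ι → M) (X V : M) : ℂ[X] :=
  ∑ T ∈ Sᶜ.powerset,
    Polynomial.C (f (T.piecewise (fun _ ↦ V) (S.piecewise C fun _ ↦ X))) * Polynomial.X ^ T.card

variable (f : MultilinearMap ℂ (fun _ : ι ↦ M) ℂ) (S : Finset ι) (C : ι → M) (X V : M)

omit [Fintype ι] in
theorem map_piecewise_const_smul (T : Finset ι) (s : ℂ) (w : ι → M) :
    f (T.piecewise (fun _ ↦ s • V) w) = s ^ T.card * f (T.piecewise (fun _ ↦ V) w) := by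
  have h := f.map_piecewise_smul (fun _ ↦ s) (T.piecewise (fun _ ↦ V) w) T
  rw [Finset.prod_const, smul_eq_mul] at h
  rw [← h]
  congr 1
  ext i
  by_cases hi : i ∈ T <;> simp [hi]

theorem eval_linePolynomial (s : ℂ) :
    (f.linePolynomial S C X V).eval s = f (S.piecewise C fun _ ↦ X + s • V) := by
  have h := f.map_piecewise_add (fun _ ↦ s • V) (S.piecewise C fun _ ↦ X) Sᶜ
  have hw : Sᶜ.piecewise ((fun _ ↦ s • V) + S.piecewise C fun _ ↦ X)
      (S.piecewise C fun _ ↦ X) = S.piecewise C fun _ ↦ X + s • V := by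
    ext i
    by_cases hi : i ∈ S <;> simp [hi, add_comm]
  rw [hw] at h
  rw [h, linePolynomial, Polynomial.eval_finsetSum]
  refine Finset.sum_congr rfl fun T _ ↦ ?_
  rw [map_piecewise_const_smul]
  rw [Polynomial.eval_C_mul, Polynomial.eval_X_pow, mul_comm]

theorem coeff_card_linePolynomial :
    (f.linePolynomial S C X V).coeff Sᶜ.card = f (S.piecewise C fun _ ↦ V) := by
  rw [linePolynomial, Polynomial.finsetSum_coeff, Finset.sum_eq_single Sᶜ]
  · rw [Polynomial.coeff_C_mul_X_pow, if_pos rfl]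
    congr 1
    ext i
    by_cases hi : i ∈ S <;> simp [hi]
  · intro T hT hne
    rw [Polynomial.coeff_C_mul_X_pow, if_neg]
    exact fun hc ↦ hne (Finset.eq_of_subset_of_card_le (Finset.mem_powerset.1 hT) hc.le)
  · simp

theorem coeff_one_linePolynomial
    (hf : ∀ (π : Equiv.Perm ι) (w : ι → M), f (w ∘ π) = f w) {a : ι} (ha : a ∉ S) :
    (f.linePolynomial S C X (C a)).coeff 1 =
      Sᶜ.card * f ((insert a S).piecewise C fun _ ↦ X) := by
  rw [linePolynomial, Polynomial.finsetSum_coeff]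
  simp_rw [Polynomial.coeff_C_mul_X_pow]
  rw [← Finset.sum_filter]
  simp_rw [eq_comm (a := 1)]
  rw [← Finset.powersetCard_eq_filter, Finset.powersetCard_one, Finset.sum_map,
    Finset.sum_congr rfl (g := fun _ ↦ f ((insert a S).piecewise C fun _ ↦ X)),
    Finset.sum_const, nsmul_eq_mul]
  intro j hj
  rw [Finset.mem_compl] at hj
  rw [← hf (Equiv.swap a j)]
  congr 1
  ext i
  by_cases hia : i = a
  · subst hia
    simp
  by_cases hij : i = j
  · subst hij
    simp [Finset.piecewise, ha, hj, hia, Ne.symm hia]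
  · simp [Finset.piecewise, Equiv.swap_apply_of_ne_of_ne hia hij, hia, hij]

/-- Polarization preserves stability: if a symmetric multilinear form does not vanish on the
diagonal over a set `H` invariant under translation by `s • V` for `V ∈ K` and `0 ≤ im s`, then
filling some of the entries with elements of `K` keeps it nonzero on `H`. -/
theorem map_piecewise_ne_zero {H K : Set M}
    (hf : ∀ (π : Equiv.Perm ι) (w : ι → M), f (w ∘ π) = f w)
    (hH : ∀ X ∈ H, f (fun _ ↦ X) ≠ 0)
    (hadd : ∀ X ∈ H, ∀ V ∈ K, ∀ s : ℂ, 0 ≤ s.im → X + s • V ∈ H)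
    (hI : ∀ V ∈ K, Complex.I • V ∈ H)
    (hC : ∀ i ∈ S, C i ∈ K) (hX : X ∈ H) : f (S.piecewise C fun _ ↦ X) ≠ 0 := by
  induction S using Finset.induction generalizing X with
  | empty => simpa using hH X hX
  | insert a S ha ih =>
    replace ih := ih (hC := fun i hi ↦ hC i (Finset.mem_insert_of_mem hi))
    have haK := hC a (Finset.mem_insert_self a S)
    have hlead : f (S.piecewise C fun _ ↦ C a) ≠ 0 := by
      have h := ih _ (hI _ haK)
      rw [← Finset.piecewise_compl, map_piecewise_const_smul, Finset.piecewise_compl] at h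
      exact right_ne_zero_of_mul h
    have hcard : Sᶜ.card ≠ 0 :=
      Finset.card_ne_zero_of_mem (Finset.mem_compl.2 ha)
    have h1 := coeff_one_ne_zero_of_forall_eval_ne_zero hcard
      (p := f.linePolynomial S C X (C a)) (by rwa [coeff_card_linePolynomial])
      fun s hs ↦ by
        rw [eval_linePolynomial]
        exact ih _ (hadd X hX _ haK s hs)
    rw [coeff_one_linePolynomial f S C X hf ha] at h1
    exact right_ne_zero_of_mul h1

end MultilinearMap

namespace Matrix

variable {ι : Type*} [Fintype ι]

open scoped ComplexOrder MatrixOrder in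
theorem PosDef.map_ofReal [DecidableEq ι] {A : Matrix ι ι ℝ} (hA : A.PosDef) :
    (A.map Complex.ofReal).PosDef := by
  have hdet : (A.map Complex.ofReal).det ≠ 0 := by
    have h := Complex.ofRealHom.map_det A
    rw [RingHom.mapMatrix_apply] at h
    exact h ▸ Complex.ofReal_ne_zero.2 hA.det_pos.ne'
  obtain ⟨B, hB⟩ := CStarAlgebra.nonneg_iff_eq_star_mul_self.mp hA.posSemidef.nonneg
  have hmap : A.map Complex.ofReal = (B.map Complex.ofReal)ᴴ * B.map Complex.ofReal := by
    rw [hB]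
    ext i j
    simp [Matrix.mul_apply, star_eq_conjTranspose]
  refine (PosSemidef.posDef_iff_det_ne_zero ?_).2 hdet
  rw [hmap]
  exact posSemidef_conjTranspose_mul_self _

variable (ι) in
open scoped ComplexOrder in
/-- The complex matrices `R + i P` with `R` Hermitian and `P` positive definite. -/
def upperHalfSpace : Set (Matrix ι ι ℂ) :=
  {X | ∃ R P : Matrix ι ι ℂ, R.IsHermitian ∧ P.PosDef ∧ X = R + Complex.I • P}

open scoped ComplexOrder in
theorem det_ne_zero_of_mem_upperHalfSpace [DecidableEq ι] {X : Matrix ι ι ℂ}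
    (hX : X ∈ upperHalfSpace ι) : X.det ≠ 0 := by
  obtain ⟨R, P, hR, hP, rfl⟩ := hX
  intro h
  obtain ⟨v, hv, hv0⟩ := Matrix.exists_mulVec_eq_zero_iff.2 h
  have h1 := congrArg (star v ⬝ᵥ ·) hv0
  simp only [add_mulVec, dotProduct_add, smul_mulVec, dotProduct_smul, dotProduct_zero,
    smul_eq_mul] at h1
  have h2 := congrArg Complex.im h1
  have h3 : (star v ⬝ᵥ R *ᵥ v).im = 0 := hR.im_star_dotProduct_mulVec_self v
  have h4 := (Complex.pos_iff.1 (hP.dotProduct_mulVec_pos hv)).1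
  simp [h3] at h2
  exact h4.ne' h2

omit [Fintype ι] in
open scoped ComplexOrder in
theorem add_smul_mem_upperHalfSpace {X V : Matrix ι ι ℂ} (hX : X ∈ upperHalfSpace ι)
    (hV : V.PosDef) {s : ℂ} (hs : 0 ≤ s.im) : X + s • V ∈ upperHalfSpace ι := by
  obtain ⟨R, P, hR, hP, rfl⟩ := hX
  refine ⟨R + (s.re : ℂ) • V, P + (s.im : ℂ) • V, hR.add (hV.1.smul (Complex.conj_ofReal _)),
    hP.add_posSemidef (hV.posSemidef.smul (by exact_mod_cast hs)), ?_⟩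
  conv_lhs => rw [← Complex.re_add_im s]
  module

omit [Fintype ι] in
open scoped ComplexOrder in
theorem add_smul_mem_upperHalfSpace_of_isHermitian {R V : Matrix ι ι ℂ} (hR : R.IsHermitian)
    (hV : V.PosDef) {s : ℂ} (hs : 0 < s.im) : R + s • V ∈ upperHalfSpace ι := by
  refine ⟨R + (s.re : ℂ) • V, (s.im : ℂ) • V, hR.add (hV.1.smul (Complex.conj_ofReal _)),
    hV.smul (by exact_mod_cast hs), ?_⟩
  conv_lhs => rw [← Complex.re_add_im s]
  module

variable (ι) in
/-- The unnormalized mixed discriminant of complex matrices as a multilinear map. -/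
noncomputable def mixedDet [DecidableEq ι] :
    MultilinearMap ℂ (fun _ : ι ↦ Matrix ι ι ℂ) ℂ :=
  ∑ σ : Equiv.Perm ι, ∑ τ : Equiv.Perm ι,
    (((Equiv.Perm.sign σ : ℤ) : ℂ) * ((Equiv.Perm.sign τ : ℤ) : ℂ)) •
      (MultilinearMap.mkPiAlgebra ℂ ι ℂ).compLinearMap
        fun k ↦ Matrix.entryLinearMap ℂ ℂ (σ k) (τ k)

variable [DecidableEq ι]

theorem mixedDet_apply (A : ι → Matrix ι ι ℂ) :
    mixedDet ι A = ∑ σ : Equiv.Perm ι, ∑ τ : Equiv.Perm ι,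
      ((Equiv.Perm.sign σ : ℤ) : ℂ) * ((Equiv.Perm.sign τ : ℤ) : ℂ) *
        ∏ k, A k (σ k) (τ k) := by
  simp [mixedDet]

theorem mixedDet_comp_perm (π : Equiv.Perm ι) (A : ι → Matrix ι ι ℂ) :
    mixedDet ι (A ∘ π) = mixedDet ι A := by
  rw [mixedDet_apply, mixedDet_apply,
    ← Equiv.sum_comp (Equiv.mulRight π)]
  refine Finset.sum_congr rfl fun σ _ ↦ ?_
  rw [← Equiv.sum_comp (Equiv.mulRight π)]
  refine Finset.sum_congr rfl fun τ _ ↦ ?_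
  have h : (((Equiv.Perm.sign π : ℤ) : ℂ)) * ((Equiv.Perm.sign π : ℤ) : ℂ) = 1 := by
    rcases Int.units_eq_one_or (Equiv.Perm.sign π) with h | h <;> simp [h]
  have hprod := Equiv.prod_comp π fun k ↦ A k (σ k) (τ k)
  simp only [Equiv.coe_mulRight, Equiv.Perm.sign_mul, Units.val_mul, Int.cast_mul,
    Function.comp_apply, Equiv.Perm.mul_apply, hprod]
  linear_combination ((Equiv.Perm.sign σ : ℤ) : ℂ) * ((Equiv.Perm.sign τ : ℤ) : ℂ) *
    (∏ k, A k (σ k) (τ k)) * h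

theorem mixedDet_const (X : Matrix ι ι ℂ) :
    mixedDet ι (fun _ ↦ X) = (Fintype.card ι).factorial * X.det := by
  have h (σ : Equiv.Perm ι) : ∑ τ : Equiv.Perm ι,
      ((Equiv.Perm.sign σ : ℤ) : ℂ) * ((Equiv.Perm.sign τ : ℤ) : ℂ) *
        ∏ k, X (σ k) (τ k) = X.det := by
    have hd := Matrix.det_permute σ X
    rw [← Matrix.det_transpose, Matrix.det_apply'] at hd
    simp_rw [mul_assoc, ← Finset.mul_sum]
    simp only [transpose_apply, submatrix_apply, id] at hd
    rw [hd, ← mul_assoc]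
    rcases Int.units_eq_one_or (Equiv.Perm.sign σ) with h | h <;> simp [h]
  rw [mixedDet_apply, Finset.sum_congr rfl fun σ _ ↦ h σ, Finset.sum_const, Finset.card_univ,
    Fintype.card_perm, nsmul_eq_mul]

end Matrix

theorem ofReal_mixedDisc {n : ℕ} (A : Fin n → Matrix (Fin n) (Fin n) ℝ) :
    (mixedDisc A : ℂ) =
      (n.factorial : ℂ)⁻¹ * Matrix.mixedDet (Fin n) fun k ↦ (A k).map Complex.ofReal := by
  simp [mixedDisc, Matrix.mixedDet_apply]

theorem mixedDisc2_comm {n : ℕ} (A B : Matrix (Fin (n + 2)) (Fin (n + 2)) ℝ)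
    (C : Fin (n + 2) → Matrix (Fin (n + 2)) (Fin (n + 2)) ℝ) :
    mixedDisc2 A B C = mixedDisc2 B A C := by
  apply Complex.ofReal_injective
  rw [mixedDisc2, mixedDisc2, ofReal_mixedDisc, ofReal_mixedDisc,
    ← Matrix.mixedDet_comp_perm (Equiv.swap 0 1)]
  congr 2
  ext k : 1
  by_cases h0 : k = 0
  · subst h0
    simp
  by_cases h1 : k = 1
  · subst h1
    simp
  · simp [Equiv.swap_apply_of_ne_of_ne h0 h1, h0, h1]

/-- The complexified mixed discriminant is a quadratic polynomial along `A + s B`. -/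
theorem mixedDet_piecewise_add_smul {n : ℕ} (A B : Matrix (Fin (n + 2)) (Fin (n + 2)) ℝ)
    (C : Fin (n + 2) → Matrix (Fin (n + 2)) (Fin (n + 2)) ℝ) (s : ℂ) :
    Matrix.mixedDet (Fin (n + 2)) (({0, 1}ᶜ : Finset (Fin (n + 2))).piecewise
        (fun k ↦ (C k).map Complex.ofReal)
        fun _ ↦ A.map Complex.ofReal + s • B.map Complex.ofReal) =
      (n + 2).factorial *
        (mixedDisc2 A A C + 2 * s * mixedDisc2 A B C + s ^ 2 * mixedDisc2 B B C) := by
  set f := Matrix.mixedDet (Fin (n + 2))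
  set c : Fin (n + 2) → Matrix (Fin (n + 2)) (Fin (n + 2)) ℂ := fun k ↦ (C k).map Complex.ofReal
  have hne : (0 : Fin (n + 2)) ≠ 1 := by simp
  have hw (X Y : Matrix (Fin (n + 2)) (Fin (n + 2)) ℝ) :
      f (Function.update (Function.update c 0 (X.map Complex.ofReal)) 1 (Y.map Complex.ofReal)) =
        (n + 2).factorial * mixedDisc2 X Y C := by
    rw [mixedDisc2, ofReal_mixedDisc,
      mul_inv_cancel_left₀ (by exact_mod_cast Nat.factorial_ne_zero _)]
    congr 1
    ext k : 1
    by_cases h1 : k = 1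
    · subst h1
      simp
    by_cases h0 : k = 0
    · subst h0
      simp
    · simp [h0, h1, c]
  have hpw (Z : Matrix (Fin (n + 2)) (Fin (n + 2)) ℂ) :
      ({0, 1}ᶜ : Finset (Fin (n + 2))).piecewise c (fun _ ↦ Z) =
        Function.update (Function.update c 0 Z) 1 Z := by
    ext k : 1
    by_cases h1 : k = 1
    · subst h1
      simp [Finset.piecewise]
    by_cases h0 : k = 0
    · subst h0
      simp [Finset.piecewise]
    · simp [Finset.piecewise, h0, h1]
  rw [hpw, f.map_update_add, f.map_update_smul, Function.update_comm hne,
    Function.update_comm hne, f.map_update_add, f.map_update_smul, f.map_update_add,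
    f.map_update_smul]
  simp only [Function.update_comm hne.symm, hw, mixedDisc2_comm B A C, smul_eq_mul]
  ring

/-- Alexandrov's mixed discriminant inequality: for `A` symmetric and
`B, C₃, …, Cₙ` symmetric positive definite,
`Q(A, B, C₃, …, Cₙ)² ≥ Q(A, A, C₃, …, Cₙ) · Q(B, B, C₃, …, Cₙ)`. -/
theorem stmt7 {n : ℕ} (A B : Matrix (Fin (n + 2)) (Fin (n + 2)) ℝ)
    (C : Fin (n + 2) → Matrix (Fin (n + 2)) (Fin (n + 2)) ℝ)
    (hA : A.IsSymm) (hB : B.PosDef)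
    (hC : ∀ k, k ≠ 0 → k ≠ 1 → (C k).PosDef) :
    mixedDisc2 A A C * mixedDisc2 B B C ≤ (mixedDisc2 A B C) ^ 2 := by
  open scoped ComplexOrder in
  by_contra! hlt
  set a := mixedDisc2 A A C
  set b := mixedDisc2 A B C
  set q := mixedDisc2 B B C
  have hq : q ≠ 0 := fun h ↦ by
    rw [h, mul_zero] at hlt
    exact hlt.not_ge (sq_nonneg b)
  set e := √((a * q - b ^ 2) / q ^ 2)
  have hpos : 0 < (a * q - b ^ 2) / q ^ 2 := by
    have := sub_pos.2 hlt
    positivity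
  have he : 0 < e := Real.sqrt_pos.2 hpos
  have he2 : e ^ 2 * q ^ 2 = a * q - b ^ 2 := by
    rw [Real.sq_sqrt hpos.le, div_mul_cancel₀ _ (pow_ne_zero 2 hq)]
  set s : ℂ := ((-b / q : ℝ) : ℂ) + (e : ℂ) * Complex.I
  have hs : 0 < s.im := by simpa [s] using he
  have hAh : (A.map Complex.ofReal).IsHermitian :=
    Matrix.IsHermitian.map ((Matrix.conjTranspose_eq_transpose_of_trivial A).trans hA) _
      fun x ↦ by simp
  have hX := Matrix.add_smul_mem_upperHalfSpace_of_isHermitian hAh hB.map_ofReal hs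
  refine (Matrix.mixedDet (Fin (n + 2))).map_piecewise_ne_zero {0, 1}ᶜ
    (fun k ↦ (C k).map Complex.ofReal) _ (K := {V | V.PosDef}) Matrix.mixedDet_comp_perm
    (fun X hX ↦ ?_) (fun X hX V hV s hs ↦ Matrix.add_smul_mem_upperHalfSpace hX hV hs)
    (fun V hV ↦ ⟨0, V, Matrix.isHermitian_zero, hV, (zero_add _).symm⟩) (fun k hk ↦ ?_) hX ?_
  · rw [Matrix.mixedDet_const]
    exact mul_ne_zero (by exact_mod_cast Nat.factorial_ne_zero _)
      (Matrix.det_ne_zero_of_mem_upperHalfSpace hX)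
  · simp only [Finset.mem_compl, Finset.mem_insert, Finset.mem_singleton, not_or] at hk
    exact (hC k hk.1 hk.2).map_ofReal
  · rw [mixedDet_piecewise_add_smul]
    refine mul_eq_zero_of_right _ ?_
    have hq' : (q : ℂ) ≠ 0 := Complex.ofReal_ne_zero.2 hq
    have he2' : (e : ℂ) ^ 2 * (q : ℂ) ^ 2 = a * q - b ^ 2 := by exact_mod_cast he2
    have hsq : s * q = -b + e * q * Complex.I := by
      simp only [s, Complex.ofReal_div, Complex.ofReal_neg]
      field_simp
    apply mul_right_cancel₀ hq'
    linear_combination (s * q + 2 * b + (-b + e * q * Complex.I)) * hsq - he2' +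
      (e : ℂ) ^ 2 * (q : ℂ) ^ 2 * Complex.I_sq
end

section
/- Equality case of Alexandrov's mixed discriminant inequality: let n ≥ 2, let A be a symmetric real n×n matrix, and let B, C₃, …, Cₙ be symmetric positive definite real n×n matrices. Then equality Q(A, B, C₃, …, Cₙ)² = Q(A, A, C₃, …, Cₙ) · Q(B, B, C₃, …, Cₙ) holds if and only if A = c·B for some real constant c. -/
section MixedDiscriminant

open Matrix Equiv

/-- The mixed discriminant without its normalising factor `1 / n!`. -/
noncomputable def discSum {n : ℕ} (A : Fin n → Matrix (Fin n) (Fin n) ℝ) : ℝ :=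
  ∑ σ : Perm (Fin n), ∑ τ : Perm (Fin n),
    ((Perm.sign σ : ℤ) : ℝ) * ((Perm.sign τ : ℤ) : ℝ) * ∏ k, A k (σ k) (τ k)

theorem discSum_eq_sum_det {n : ℕ} (A : Fin n → Matrix (Fin n) (Fin n) ℝ) :
    discSum A = ∑ σ : Perm (Fin n),
      ((Perm.sign σ : ℤ) : ℝ) * (Matrix.of fun k j => A k (σ k) j).det := by
  refine Finset.sum_congr rfl fun σ _ => ?_
  rw [← det_transpose, det_apply', Finset.mul_sum]
  refine Finset.sum_congr rfl fun τ _ => ?_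
  simp [mul_assoc]

theorem discSum_transpose {n : ℕ} (A : Fin n → Matrix (Fin n) (Fin n) ℝ) :
    discSum (fun k => (A k)ᵀ) = discSum A := by
  unfold discSum
  rw [Finset.sum_comm]
  refine Finset.sum_congr rfl fun σ _ => Finset.sum_congr rfl fun τ _ => ?_
  simp [mul_comm]

theorem discSum_mul_right {n : ℕ} (A : Fin n → Matrix (Fin n) (Fin n) ℝ)
    (S : Matrix (Fin n) (Fin n) ℝ) :
    discSum (fun k => A k * S) = S.det * discSum A := by
  simp_rw [discSum_eq_sum_det, Finset.mul_sum]
  refine Finset.sum_congr rfl fun σ _ => ?_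
  have : (Matrix.of fun k j => (A k * S) (σ k) j) = (Matrix.of fun k j => A k (σ k) j) * S := by
    ext k j
    simp [Matrix.mul_apply]
  rw [this, det_mul]
  ring

theorem discSum_congr {n : ℕ} (A : Fin n → Matrix (Fin n) (Fin n) ℝ)
    (S : Matrix (Fin n) (Fin n) ℝ) :
    discSum (fun k => Sᵀ * A k * S) = S.det ^ 2 * discSum A := by
  rw [discSum_mul_right, ← discSum_transpose]
  simp_rw [transpose_mul, transpose_transpose]
  rw [discSum_mul_right, discSum_transpose]
  ring

theorem discSum_comp_perm {n : ℕ} (A : Fin n → Matrix (Fin n) (Fin n) ℝ) (π : Perm (Fin n)) :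
    discSum (A ∘ π) = discSum A := by
  unfold discSum
  rw [← Equiv.sum_comp (Equiv.mulRight π)]
  refine Finset.sum_congr rfl fun σ _ => ?_
  rw [← Equiv.sum_comp (Equiv.mulRight π)]
  refine Finset.sum_congr rfl fun τ _ => ?_
  have h : ((Perm.sign π : ℤ) : ℝ) * ((Perm.sign π : ℤ) : ℝ) = 1 := by
    rcases Int.units_eq_one_or (Perm.sign π) with h | h <;> simp [h]
  rw [← Equiv.prod_comp π fun k => A k (σ k) (τ k)]
  simp only [coe_mulRight, Perm.sign_mul, Units.val_mul, Int.cast_mul, Perm.coe_mul,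
    Function.comp_apply]
  linear_combination (((Perm.sign σ : ℤ) : ℝ) * ((Perm.sign τ : ℤ) : ℝ) *
    ∏ k, A (π k) (σ (π k)) (τ (π k))) * h

theorem discSum_swap_zero_one {n : ℕ} (X Y : Matrix (Fin (n + 2)) (Fin (n + 2)) ℝ)
    (R : Fin n → Matrix (Fin (n + 2)) (Fin (n + 2)) ℝ) :
    discSum (Fin.cons X (Fin.cons Y R)) = discSum (Fin.cons Y (Fin.cons X R)) := by
  rw [← discSum_comp_perm _ (Equiv.swap 0 (Fin.succ 0))]
  congr 1
  funext k
  refine Fin.cases ?_ (fun k => Fin.cases ?_ (fun k => ?_) k) k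
  · rw [Function.comp_apply, Equiv.swap_apply_left]
    rfl
  · rw [Function.comp_apply, Equiv.swap_apply_right]
    rfl
  · rw [Function.comp_apply, Equiv.swap_apply_of_ne_of_ne (Fin.succ_ne_zero _)
      (fun h => Fin.succ_ne_zero _ (Fin.succ_injective _ h))]
    rfl

theorem discSum_swap_one_two {n : ℕ} (X Y Z : Matrix (Fin (n + 3)) (Fin (n + 3)) ℝ)
    (R : Fin n → Matrix (Fin (n + 3)) (Fin (n + 3)) ℝ) :
    discSum (Fin.cons X (Fin.cons Y (Fin.cons Z R))) =
      discSum (Fin.cons X (Fin.cons Z (Fin.cons Y R))) := by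
  rw [← discSum_comp_perm _ (Equiv.swap (Fin.succ 0) (Fin.succ (Fin.succ 0)))]
  congr 1
  funext k
  refine Fin.cases ?_ (fun k => Fin.cases ?_ (fun k => Fin.cases ?_ (fun k => ?_) k) k) k
  · rw [Function.comp_apply, Equiv.swap_apply_of_ne_of_ne (Fin.succ_ne_zero _).symm
      (Fin.succ_ne_zero _).symm]
    rfl
  · rw [Function.comp_apply, Equiv.swap_apply_left]
    rfl
  · rw [Function.comp_apply, Equiv.swap_apply_right]
    rfl
  · rw [Function.comp_apply, Equiv.swap_apply_of_ne_of_ne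
      (fun h => Fin.succ_ne_zero _ (Fin.succ_injective _ h))
      (fun h => Fin.succ_ne_zero _ (Fin.succ_injective _ (Fin.succ_injective _ h)))]
    rfl

theorem discSum_cons_add {n : ℕ} (X Y : Matrix (Fin (n + 1)) (Fin (n + 1)) ℝ)
    (R : Fin n → Matrix (Fin (n + 1)) (Fin (n + 1)) ℝ) :
    discSum (Fin.cons (X + Y) R) = discSum (Fin.cons X R) + discSum (Fin.cons Y R) := by
  simp only [discSum, Fin.prod_univ_succ, Fin.cons_zero, Fin.cons_succ, Matrix.add_apply,
    ← Finset.sum_add_distrib]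
  refine Finset.sum_congr rfl fun σ _ => Finset.sum_congr rfl fun τ _ => ?_
  ring

theorem discSum_cons_smul {n : ℕ} (c : ℝ) (X : Matrix (Fin (n + 1)) (Fin (n + 1)) ℝ)
    (R : Fin n → Matrix (Fin (n + 1)) (Fin (n + 1)) ℝ) :
    discSum (Fin.cons (c • X) R) = c * discSum (Fin.cons X R) := by
  simp only [discSum, Fin.prod_univ_succ, Fin.cons_zero, Fin.cons_succ, Matrix.smul_apply,
    Finset.mul_sum, smul_eq_mul]
  refine Finset.sum_congr rfl fun σ _ => Finset.sum_congr rfl fun τ _ => ?_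
  ring

/-- `discSum` as a symmetric bilinear form in its first two arguments. -/
noncomputable def discBilin {n : ℕ} (C : Fin n → Matrix (Fin (n + 2)) (Fin (n + 2)) ℝ) :
    Matrix (Fin (n + 2)) (Fin (n + 2)) ℝ →ₗ[ℝ] Matrix (Fin (n + 2)) (Fin (n + 2)) ℝ →ₗ[ℝ] ℝ :=
  LinearMap.mk₂ ℝ (fun X Y => discSum (Fin.cons X (Fin.cons Y C)))
    (fun X X' Y => discSum_cons_add X X' _)
    (fun c X Y => discSum_cons_smul c X _)
    (fun X Y Y' => by
      simp only [discSum_swap_zero_one X]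
      exact discSum_cons_add Y Y' _)
    (fun c X Y => by
      simp only [discSum_swap_zero_one X]
      exact discSum_cons_smul c Y _)

theorem discBilin_apply {n : ℕ} (C : Fin n → Matrix (Fin (n + 2)) (Fin (n + 2)) ℝ)
    (X Y : Matrix (Fin (n + 2)) (Fin (n + 2)) ℝ) :
    discBilin C X Y = discSum (Fin.cons X (Fin.cons Y C)) := rfl

theorem discBilin_comm {n : ℕ} (C : Fin n → Matrix (Fin (n + 2)) (Fin (n + 2)) ℝ)
    (X Y : Matrix (Fin (n + 2)) (Fin (n + 2)) ℝ) :
    discBilin C X Y = discBilin C Y X :=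
  discSum_swap_zero_one X Y C

theorem discBilin_congr {n : ℕ} (C : Fin n → Matrix (Fin (n + 2)) (Fin (n + 2)) ℝ)
    (X Y S : Matrix (Fin (n + 2)) (Fin (n + 2)) ℝ) :
    discBilin (fun k => Sᵀ * C k * S) (Sᵀ * X * S) (Sᵀ * Y * S) =
      S.det ^ 2 * discBilin C X Y := by
  rw [discBilin_apply, discBilin_apply, ← discSum_congr]
  congr 1
  funext k
  refine Fin.cases ?_ (fun k => Fin.cases ?_ (fun k => ?_) k) k <;> simp

/-- The principal submatrix obtained by deleting the `i`-th row and column. -/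
def deleteRowCol {n : ℕ} (i : Fin (n + 1)) (X : Matrix (Fin (n + 1)) (Fin (n + 1)) ℝ) :
    Matrix (Fin n) (Fin n) ℝ :=
  X.submatrix i.succAbove i.succAbove

theorem det_of_row_zero_eq_single {n : ℕ} (i : Fin (n + 1)) (c : ℝ)
    (N : Matrix (Fin (n + 1)) (Fin (n + 1)) ℝ) (h : ∀ j, N 0 j = if j = i then c else 0) :
    N.det = (-1) ^ (i : ℕ) * c * (N.submatrix Fin.succ i.succAbove).det := by
  rw [det_succ_row_zero, Finset.sum_eq_single i]
  · simp [h]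
  · intro j _ hj
    simp [h, hj]
  · simp

theorem discSum_cons_single {n : ℕ} (i : Fin (n + 1))
    (R : Fin n → Matrix (Fin (n + 1)) (Fin (n + 1)) ℝ) :
    discSum (Fin.cons (Matrix.single i i 1) R) = discSum fun k => deleteRowCol i (R k) := by
  have hrow (σ : Perm (Fin (n + 1))) :
      (Matrix.of fun k j => (Fin.cons (Matrix.single i i (1 : ℝ)) R :
        Fin (n + 1) → Matrix (Fin (n + 1)) (Fin (n + 1)) ℝ) k (σ k) j).det =
      (-1) ^ (i : ℕ) * (if σ 0 = i then 1 else 0) *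
        ∑ τ : Perm (Fin n), ((Perm.sign τ : ℤ) : ℝ) *
          ∏ k : Fin n, R k (σ k.succ) (i.succAbove (τ k)) := by
    rw [det_of_row_zero_eq_single i (if σ 0 = i then 1 else 0)]
    · rw [← det_transpose, det_apply']
      simp
    · intro j
      simp [Matrix.single_apply, eq_comm, ite_and]
      split_ifs <;> simp
  have hcol (τ : Perm (Fin n)) :
      ∑ σ : Perm (Fin (n + 1)), ((Perm.sign σ : ℤ) : ℝ) * ((if σ 0 = i then 1 else 0) *
          ∏ k : Fin n, R k (σ k.succ) (i.succAbove (τ k))) =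
        (-1) ^ (i : ℕ) * ∑ σ : Perm (Fin n), ((Perm.sign σ : ℤ) : ℝ) *
          ∏ k : Fin n, R k (i.succAbove (σ k)) (i.succAbove (τ k)) := by
    have h := det_of_row_zero_eq_single i 1 (Matrix.of (Fin.cons (fun j => if j = i then 1 else 0)
      fun k j => R k j (i.succAbove (τ k)))) (by simp)
    rw [← det_transpose, det_apply', ← det_transpose (Matrix.submatrix _ _ _), det_apply'] at h
    simpa [Fin.prod_univ_succ] using h
  rw [discSum_eq_sum_det]
  simp_rw [hrow]
  calc _ = (-1) ^ (i : ℕ) * ∑ τ : Perm (Fin n), ((Perm.sign τ : ℤ) : ℝ) *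
        ∑ σ : Perm (Fin (n + 1)), ((Perm.sign σ : ℤ) : ℝ) * ((if σ 0 = i then 1 else 0) *
          ∏ k : Fin n, R k (σ k.succ) (i.succAbove (τ k))) := by
        simp_rw [Finset.mul_sum]
        rw [Finset.sum_comm]
        refine Finset.sum_congr rfl fun σ _ => Finset.sum_congr rfl fun τ _ => ?_
        ring
    _ = _ := by
        simp_rw [hcol]
        unfold discSum
        rw [Finset.sum_comm]
        simp_rw [Finset.mul_sum]
        refine Finset.sum_congr rfl fun σ _ => Finset.sum_congr rfl fun τ _ => ?_
        have : (-1 : ℝ) ^ (i : ℕ) * (-1) ^ (i : ℕ) = 1 := by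
          rw [← mul_pow]; simp
        simp only [deleteRowCol, submatrix_apply]
        linear_combination (((Perm.sign σ : ℤ) : ℝ) * ((Perm.sign τ : ℤ) : ℝ) *
          ∏ k : Fin n, R k (i.succAbove (τ k)) (i.succAbove (σ k))) * this

theorem exists_orthogonal_diagonal {m : Type*} [Fintype m] [DecidableEq m] {A : Matrix m m ℝ}
    (hA : A.IsSymm) :
    ∃ (U : Matrix m m ℝ) (x : m → ℝ), Uᵀ * U = 1 ∧ Uᵀ * A * U = diagonal x := by
  have hA' : A.IsHermitian := by simpa [IsHermitian] using hA.eq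
  refine ⟨hA'.eigenvectorUnitary, hA'.eigenvalues, ?_, ?_⟩
  · exact (Unitary.coe_star_mul_self hA'.eigenvectorUnitary)
  · have h := hA'.conjStarAlgAut_star_eigenvectorUnitary
    rw [Unitary.conjStarAlgAut_apply] at h
    simpa [star_eq_conjTranspose] using h

theorem exists_congr_one {m : Type*} [Fintype m] [DecidableEq m] {E : Matrix m m ℝ}
    (hE : E.PosDef) : ∃ T : Matrix m m ℝ, T.det ≠ 0 ∧ Tᵀ * E * T = 1 := by
  obtain ⟨U, x, hU, hx⟩ := exists_orthogonal_diagonal (A := E) (by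
    simpa [IsHermitian, IsSymm] using hE.isHermitian)
  have hinj : Function.Injective U.mulVec := by
    intro v w h
    have := congrArg (fun z => Uᵀ *ᵥ z) h
    simpa [hU] using this
  have hpos : ∀ i, 0 < x i := by
    rw [← posDef_diagonal_iff, ← hx]
    simpa using hE.conjTranspose_mul_mul_same hinj
  have hT : (U * diagonal fun i => (√(x i))⁻¹)ᵀ * E * (U * diagonal fun i => (√(x i))⁻¹) = 1 := by
    rw [transpose_mul, diagonal_transpose]
    calc _ = diagonal (fun i => (√(x i))⁻¹) * (Uᵀ * E * U) * diagonal (fun i => (√(x i))⁻¹) := by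
          simp only [Matrix.mul_assoc]
      _ = 1 := by
          rw [hx, diagonal_mul_diagonal, diagonal_mul_diagonal, ← diagonal_one]
          congr 1
          funext i
          have h := Real.sqrt_pos.2 (hpos i)
          have h' := Real.mul_self_sqrt (hpos i).le
          field_simp
          linarith
  refine ⟨_, fun h0 => ?_, hT⟩
  have := congrArg det hT
  rw [det_mul, h0] at this
  simp at this

theorem exists_congr_one_diagonal {m : Type*} [Fintype m] [DecidableEq m] {A E : Matrix m m ℝ}
    (hA : A.IsSymm) (hE : E.PosDef) :
    ∃ (T : Matrix m m ℝ) (x : m → ℝ), T.det ≠ 0 ∧ Tᵀ * E * T = 1 ∧ Tᵀ * A * T = diagonal x := by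
  obtain ⟨S, hS, hSE⟩ := exists_congr_one hE
  obtain ⟨U, x, hU, hx⟩ := exists_orthogonal_diagonal (A := Sᵀ * A * S) (by
    simp [IsSymm, transpose_mul, hA.eq, Matrix.mul_assoc])
  refine ⟨S * U, x, ?_, ?_, ?_⟩
  · have : U.det ≠ 0 := fun h0 => by
      have := congrArg det hU
      rw [det_mul, h0] at this
      simp at this
    rw [det_mul]
    exact mul_ne_zero hS this
  · calc _ = Uᵀ * (Sᵀ * E * S) * U := by simp only [transpose_mul, Matrix.mul_assoc]
      _ = 1 := by rw [hSE, Matrix.mul_one, hU]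
  · rw [← hx]
    simp only [transpose_mul, Matrix.mul_assoc]

theorem posDef_transpose_mul_mul {m : Type*} [Fintype m] [DecidableEq m] {E T : Matrix m m ℝ}
    (hE : E.PosDef) (hT : T.det ≠ 0) : (Tᵀ * E * T).PosDef := by
  have hu : IsUnit T := (isUnit_iff_isUnit_det T).2 hT.isUnit
  simpa using hE.conjTranspose_mul_mul_same (mulVec_injective_of_isUnit hu)

/-- A symmetric bilinear form that is negative definite on the orthogonal complement (within `W`)
of one vector is so on the complement of any other positive vector not orthogonal to the first. -/
theorem neg_on_orthogonal_of_neg_on_orthogonal {V : Type*} [AddCommGroup V] [Module ℝ V]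
    (q : V →ₗ[ℝ] V →ₗ[ℝ] ℝ) (hq : ∀ x y, q x y = q y x) (W : Submodule ℝ V) {e b : V}
    (hb : b ∈ W) (hbb : 0 < q b b) (hbe : q b e ≠ 0)
    (he : ∀ x ∈ W, x ≠ 0 → q x e = 0 → q x x < 0) :
    ∀ x ∈ W, x ≠ 0 → q x b = 0 → q x x < 0 := by
  intro a ha ha0 hab
  by_contra! hcon
  have hba : q b a = 0 := by rw [hq, hab]
  by_cases hz : q b e • a - q a e • b = 0
  · have h1 : q (q b e • a - q a e • b) b = 0 := by rw [hz]; simp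
    simp only [map_sub, map_smul, LinearMap.sub_apply, LinearMap.smul_apply, smul_eq_mul, hab] at h1
    have h2 : q a e = 0 := by
      have : q a e * q b b = 0 := by linarith
      exact (mul_eq_zero.1 this).resolve_right hbb.ne'
    rw [h2, zero_smul, sub_zero] at hz
    exact (smul_eq_zero.1 hz).elim hbe ha0
  · have h := he _ (W.sub_mem (W.smul_mem _ ha) (W.smul_mem _ hb)) hz (by
      simp only [map_sub, map_smul, LinearMap.sub_apply, LinearMap.smul_apply, smul_eq_mul]
      ring)
    simp only [map_sub, map_smul, LinearMap.sub_apply, LinearMap.smul_apply, smul_eq_mul,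
      hab, hba] at h
    nlinarith [mul_nonneg (sq_nonneg (q b e)) hcon, mul_nonneg (sq_nonneg (q a e)) hbb.le]

theorem mul_lt_sq_of_neg_on_orthogonal {V : Type*} [AddCommGroup V] [Module ℝ V]
    (q : V →ₗ[ℝ] V →ₗ[ℝ] ℝ) (hq : ∀ x y, q x y = q y x) (W : Submodule ℝ V) {b : V}
    (hb : b ∈ W) (hbb : 0 < q b b) (h : ∀ x ∈ W, x ≠ 0 → q x b = 0 → q x x < 0)
    {x : V} (hx : x ∈ W) (hxb : ∀ c : ℝ, x ≠ c • b) :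
    q x x * q b b < q x b ^ 2 := by
  have hlt := h (x - (q x b / q b b) • b) (W.sub_mem hx (W.smul_mem _ hb))
    (sub_ne_zero.2 (hxb _)) (by
      simp only [map_sub, map_smul, LinearMap.sub_apply, LinearMap.smul_apply, smul_eq_mul]
      field_simp
      simp)
  simp only [map_sub, map_smul, LinearMap.sub_apply, LinearMap.smul_apply, smul_eq_mul, hq b x]
    at hlt
  have h1 : q x x - q x b ^ 2 / q b b < 0 := by
    refine lt_of_eq_of_lt ?_ hlt
    field_simp
    ring
  rwa [sub_neg, lt_div_iff₀ hbb] at h1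

/-- A symmetric matrix with nonnegative off-diagonal entries and positive row sums `p` for which
every nonconstant vector satisfies `x ⬝ᵥ M x < ∑ (M x)ᵢ² / pᵢ` is negative definite on the
orthogonal complement of `p`. -/
theorem neg_on_rowSum_orthogonal {m : Type*} [Fintype m] [DecidableEq m] {M : Matrix m m ℝ}
    (hM : M.IsSymm) (hoff : ∀ i j, i ≠ j → 0 ≤ M i j) {p : m → ℝ} (hp : ∀ i, 0 < p i)
    (hMp : ∀ i, ∑ j, M i j = p i)
    (hstrict : ∀ x : m → ℝ, (∀ c : ℝ, x ≠ fun _ => c) →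
      x ⬝ᵥ (M *ᵥ x) < ∑ i, (M *ᵥ x) i ^ 2 / p i)
    {y : m → ℝ} (hy : y ≠ 0) (hyp : y ⬝ᵥ p = 0) : y ⬝ᵥ (M *ᵥ y) < 0 := by
  obtain ⟨T, l, hT, hTp, hTM⟩ := exists_congr_one_diagonal hM (PosDef.diagonal hp)
  have hTu : IsUnit T := (isUnit_iff_isUnit_det T).2 hT.isUnit
  have hMT : M * T = diagonal p * T * diagonal l := by
    have h1 : T * (Tᵀ * diagonal p) = 1 := mul_eq_one_comm.1 (by rw [hTp])
    have h2 : (diagonal p * T) * Tᵀ = 1 := by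
      rw [Matrix.mul_assoc]
      refine mul_eq_one_comm.1 ?_
      rw [Matrix.mul_assoc, h1]
    rw [← hTM]
    calc M * T = ((diagonal p * T) * Tᵀ) * (M * T) := by rw [h2, Matrix.one_mul]
      _ = _ := by simp only [Matrix.mul_assoc]
  have hcol (i k : m) : (M *ᵥ T.col k) i = l k * (p i * T i k) := by
    have := congrFun (congrFun hMT i) k
    rw [mul_diagonal, diagonal_mul] at this
    rw [mul_comm (l k), ← this]
    rfl
  have hnorm (k : m) : ∑ i, p i * T i k ^ 2 = 1 := by
    have := congrFun (congrFun hTp k) k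
    rw [one_apply_eq, Matrix.mul_apply] at this
    rw [← this]
    refine Finset.sum_congr rfl fun i _ => ?_
    rw [mul_diagonal, transpose_apply]
    ring
  have hform (k : m) : T.col k ⬝ᵥ (M *ᵥ T.col k) = l k := by
    rw [dotProduct]
    simp only [hcol, col_apply]
    refine Eq.trans ?_ (mul_one (l k))
    rw [← hnorm k, Finset.mul_sum]
    refine Finset.sum_congr rfl fun i _ => ?_
    ring
  have hle (k : m) : l k ≤ 1 := by
    have hnn : 0 ≤ ∑ i, ∑ j, M i j * (T i k - T j k) ^ 2 :=
      Finset.sum_nonneg fun i _ => Finset.sum_nonneg fun j _ => by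
        rcases eq_or_ne i j with rfl | hij
        · simp
        · exact mul_nonneg (hoff i j hij) (sq_nonneg _)
    have h1 : ∑ i, ∑ j, M i j * T i k ^ 2 = 1 := by
      simp_rw [← Finset.sum_mul, hMp, hnorm]
    have h2 : ∑ i, ∑ j, M i j * T j k ^ 2 = 1 := by
      rw [← h1, Finset.sum_comm]
      exact Finset.sum_congr rfl fun i _ => Finset.sum_congr rfl fun j _ => by rw [hM.apply]
    have h3 : ∑ i, ∑ j, M i j * (T i k * T j k) = l k := by
      rw [← hform k]
      simp only [dotProduct, mulVec, Finset.mul_sum, col_apply]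
      exact Finset.sum_congr rfl fun i _ => Finset.sum_congr rfl fun j _ => by ring
    have h4 : ∑ i, ∑ j, M i j * (T i k - T j k) ^ 2 =
        ∑ i, ∑ j, M i j * T i k ^ 2 + ∑ i, ∑ j, M i j * T j k ^ 2
          - 2 * ∑ i, ∑ j, M i j * (T i k * T j k) := by
      simp only [Finset.mul_sum, ← Finset.sum_add_distrib, ← Finset.sum_sub_distrib]
      exact Finset.sum_congr rfl fun i _ => Finset.sum_congr rfl fun j _ => by ring
    linarith
  have hneg (k : m) (hk : ∀ c : ℝ, T.col k ≠ fun _ => c) : l k < 0 := by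
    have h := hstrict _ hk
    have hsq : ∑ i, (M *ᵥ T.col k) i ^ 2 / p i = l k ^ 2 := by
      rw [← mul_one (l k ^ 2), ← hnorm k, Finset.mul_sum]
      refine Finset.sum_congr rfl fun i _ => ?_
      have := (hp i).ne'
      rw [hcol]
      field_simp
    rw [hform, hsq] at h
    by_contra! h0
    nlinarith [hle k]
  obtain ⟨z, rfl⟩ := (mulVec_surjective_iff_isUnit.2 hTu) y
  have hz : z ≠ 0 := by
    rintro rfl
    simp at hy
  have hconst (k : m) (c : ℝ) (hk : T.col k = fun _ => c) : z k = 0 := by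
    have h1 : (Tᵀ * diagonal p * T) *ᵥ z = z := by rw [hTp, one_mulVec]
    rw [← mulVec_mulVec, ← mulVec_mulVec] at h1
    rw [← congrFun h1 k]
    have hkc (i : m) : T i k = c := congrFun hk i
    simp only [mulVec, dotProduct, transpose_apply, hkc] at hyp ⊢
    rw [← Finset.mul_sum]
    simp only [diagonal_apply, ite_mul, zero_mul, Finset.sum_ite_eq, Finset.mem_univ, if_true]
    simp only [mul_comm (p _), hyp, mul_zero]
  have hquad : (T *ᵥ z) ⬝ᵥ (M *ᵥ (T *ᵥ z)) = ∑ k, l k * z k ^ 2 := by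
    have : (T *ᵥ z) ⬝ᵥ (M *ᵥ (T *ᵥ z)) = z ⬝ᵥ ((Tᵀ * M * T) *ᵥ z) := by
      rw [← mulVec_mulVec, ← mulVec_mulVec, dotProduct_mulVec z, vecMul_transpose]
    rw [this, hTM, dotProduct]
    refine Finset.sum_congr rfl fun k _ => ?_
    rw [mulVec_diagonal]
    ring
  rw [hquad]
  obtain ⟨k₀, hk₀⟩ := Function.ne_iff.1 hz
  have hterm (k : m) (hk : z k ≠ 0) : l k * z k ^ 2 < 0 :=
    mul_neg_of_neg_of_pos (hneg k fun c hc => hk (hconst k c hc)) (by positivity)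
  refine Finset.sum_neg' (fun k _ => ?_) ⟨k₀, Finset.mem_univ _, hterm k₀ hk₀⟩
  rcases eq_or_ne (z k) 0 with hk | hk
  · simp [hk]
  · exact (hterm k hk).le

theorem diagonal_eq_sum_smul_single {m : Type*} [Fintype m] [DecidableEq m] (x : m → ℝ) :
    diagonal x = ∑ i, x i • Matrix.single i i (1 : ℝ) := by
  rw [← sum_single_eq_diagonal]
  simp [Matrix.smul_single]

theorem discSum_cons_diagonal {n : ℕ} (x : Fin (n + 1) → ℝ)
    (R : Fin n → Matrix (Fin (n + 1)) (Fin (n + 1)) ℝ) :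
    discSum (Fin.cons (diagonal x) R) =
      ∑ i, x i * discSum fun k => deleteRowCol i (R k) := by
  let f : Matrix (Fin (n + 1)) (Fin (n + 1)) ℝ →ₗ[ℝ] ℝ := IsLinearMap.mk'
    (fun X => discSum (Fin.cons X R))
    ⟨fun X Y => discSum_cons_add X Y R, fun c X => discSum_cons_smul c X R⟩
  change f (diagonal x) = _
  rw [diagonal_eq_sum_smul_single, map_sum]
  refine Finset.sum_congr rfl fun i _ => ?_
  rw [map_smul, smul_eq_mul]
  exact congrArg _ (discSum_cons_single i R)

theorem posDef_deleteRowCol {n : ℕ} (i : Fin (n + 1))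
    {X : Matrix (Fin (n + 1)) (Fin (n + 1)) ℝ} (hX : X.PosDef) : (deleteRowCol i X).PosDef :=
  hX.submatrix Fin.succAbove_right_injective

theorem deleteRowCol_diagonal {n : ℕ} (i : Fin (n + 1)) (x : Fin (n + 1) → ℝ) :
    deleteRowCol i (diagonal x) = diagonal (x ∘ i.succAbove) :=
  submatrix_diagonal _ _ Fin.succAbove_right_injective

theorem deleteRowCol_one {n : ℕ} (i : Fin (n + 1)) : deleteRowCol i 1 = 1 :=
  submatrix_one _ Fin.succAbove_right_injective

theorem deleteRowCol_single {n : ℕ} (i : Fin (n + 1)) (j : Fin n) :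
    deleteRowCol i (Matrix.single (i.succAbove j) (i.succAbove j) 1) =
      Matrix.single j j 1 := by
  ext a b
  simp [deleteRowCol, Matrix.single_apply]

theorem discSum_pos {n : ℕ} {A : Fin n → Matrix (Fin n) (Fin n) ℝ} (hA : ∀ k, (A k).PosDef) :
    0 < discSum A := by
  induction n with
  | zero => simp [discSum]
  | succ n ih =>
    obtain ⟨T, hT, hT1⟩ := exists_congr_one (hA 0)
    have hcons : (fun k => Tᵀ * A k * T) =
        Fin.cons (diagonal fun _ => 1) fun k : Fin n => Tᵀ * A k.succ * T := by
      funext k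
      refine Fin.cases ?_ (fun k => ?_) k
      · simpa using hT1
      · simp
    have h := discSum_congr A T
    rw [hcons, discSum_cons_diagonal] at h
    have hpos : 0 < T.det ^ 2 * discSum A := by
      rw [← h]
      refine Finset.sum_pos (fun i _ => ?_) Finset.univ_nonempty
      rw [one_mul]
      exact ih fun k => posDef_deleteRowCol i (posDef_transpose_mul_mul (hA _) hT)
    exact pos_of_mul_pos_right hpos (sq_nonneg _)

theorem discBilin_pos {n : ℕ} {C : Fin n → Matrix (Fin (n + 2)) (Fin (n + 2)) ℝ}
    (hC : ∀ k, (C k).PosDef) {X Y : Matrix (Fin (n + 2)) (Fin (n + 2)) ℝ} (hX : X.PosDef)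
    (hY : Y.PosDef) : 0 < discBilin C X Y :=
  discSum_pos (Fin.cons hX (Fin.cons hY hC))

theorem discBilin_cons_single {n : ℕ} (i : Fin (n + 3))
    (Y E : Matrix (Fin (n + 3)) (Fin (n + 3)) ℝ)
    (R : Fin n → Matrix (Fin (n + 3)) (Fin (n + 3)) ℝ) :
    discBilin (Fin.cons E R) (Matrix.single i i 1) Y =
      discBilin (fun k => deleteRowCol i (R k)) (deleteRowCol i Y) (deleteRowCol i E) := by
  rw [discBilin_apply, discSum_cons_single, discBilin_apply]
  congr 1
  funext k
  refine Fin.cases ?_ (fun k => Fin.cases ?_ (fun k => ?_) k) k <;> simp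

theorem discBilin_cons_one {n : ℕ} (X Y : Matrix (Fin (n + 3)) (Fin (n + 3)) ℝ)
    (R : Fin n → Matrix (Fin (n + 3)) (Fin (n + 3)) ℝ) :
    discBilin (Fin.cons 1 R) X Y =
      ∑ i, discBilin (fun k => deleteRowCol i (R k)) (deleteRowCol i X)
        (deleteRowCol i Y) := by
  rw [discBilin_apply, discSum_swap_one_two, discSum_swap_zero_one, ← diagonal_one,
    discSum_cons_diagonal]
  refine Finset.sum_congr rfl fun i _ => ?_
  rw [one_mul, discBilin_apply]
  congr 1
  funext k
  refine Fin.cases ?_ (fun k => Fin.cases ?_ (fun k => ?_) k) k <;> simp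

/-- The quadratic form `X ↦ Q(X, X, C₃, …)` is negative definite on the symmetric matrices
orthogonal to `B`. -/
def NegOnOrthogonal {n : ℕ} (C : Fin n → Matrix (Fin (n + 2)) (Fin (n + 2)) ℝ)
    (B : Matrix (Fin (n + 2)) (Fin (n + 2)) ℝ) : Prop :=
  ∀ A : Matrix (Fin (n + 2)) (Fin (n + 2)) ℝ, A.IsSymm → A ≠ 0 → discBilin C A B = 0 →
    discBilin C A A < 0

/-- The subspace of symmetric matrices. -/
def symmSubmodule (m : Type*) : Submodule ℝ (Matrix m m ℝ) where
  carrier := {A | A.IsSymm}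
  add_mem' := fun hA hB => IsSymm.add hA hB
  zero_mem' := isSymm_zero
  smul_mem' := fun c _ hA => IsSymm.smul hA c

theorem Matrix.PosDef.mem_symmSubmodule {m : Type*} {B : Matrix m m ℝ} (hB : B.PosDef) :
    B ∈ symmSubmodule m := by
  change Bᵀ = B
  simpa [IsHermitian] using hB.isHermitian

theorem NegOnOrthogonal.mul_lt_sq {n : ℕ} {C : Fin n → Matrix (Fin (n + 2)) (Fin (n + 2)) ℝ}
    {A B : Matrix (Fin (n + 2)) (Fin (n + 2)) ℝ} (hC : ∀ k, (C k).PosDef) (hB : B.PosDef)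
    (h : NegOnOrthogonal C B) (hA : A.IsSymm) (hAB : ∀ c : ℝ, A ≠ c • B) :
    discBilin C A A * discBilin C B B < discBilin C A B ^ 2 :=
  mul_lt_sq_of_neg_on_orthogonal (discBilin C) (discBilin_comm C) (symmSubmodule _)
    hB.mem_symmSubmodule (discBilin_pos hC hB hB) h hA hAB

theorem discBilin_smul_self {n : ℕ} (C : Fin n → Matrix (Fin (n + 2)) (Fin (n + 2)) ℝ)
    (c : ℝ) (B : Matrix (Fin (n + 2)) (Fin (n + 2)) ℝ) :
    discBilin C (c • B) B ^ 2 = discBilin C (c • B) (c • B) * discBilin C B B := by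
  simp only [map_smul, LinearMap.smul_apply, smul_eq_mul]
  ring

theorem negOnOrthogonal_cons_one_diagonal {n : ℕ}
    (ih : ∀ C : Fin n → Matrix (Fin (n + 2)) (Fin (n + 2)) ℝ, (∀ k, (C k).PosDef) →
      NegOnOrthogonal C 1)
    {R : Fin n → Matrix (Fin (n + 3)) (Fin (n + 3)) ℝ} (hR : ∀ k, (R k).PosDef)
    {x : Fin (n + 3) → ℝ} (hx : x ≠ 0) (hx1 : discBilin (Fin.cons 1 R) (diagonal x) 1 = 0) :
    discBilin (Fin.cons 1 R) (diagonal x) (diagonal x) < 0 := by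
  set q := discBilin (Fin.cons 1 R) with hq
  let r (i : Fin (n + 3)) := discBilin fun k => deleteRowCol i (R k)
  have hRi (i : Fin (n + 3)) (k : Fin n) : (deleteRowCol i (R k)).PosDef :=
    posDef_deleteRowCol i (hR k)
  let M : Matrix (Fin (n + 3)) (Fin (n + 3)) ℝ :=
    Matrix.of fun i j => q (Matrix.single i i 1) (Matrix.single j j 1)
  let p (i : Fin (n + 3)) : ℝ := r i 1 1
  have hp (i : Fin (n + 3)) : 0 < p i := discBilin_pos (hRi i) PosDef.one PosDef.one
  have hMq (y : Fin (n + 3) → ℝ) (i : Fin (n + 3)) :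
      (M *ᵥ y) i = q (Matrix.single i i 1) (diagonal y) := by
    rw [diagonal_eq_sum_smul_single, map_sum]
    simp only [map_smul, smul_eq_mul, mulVec, dotProduct, M, of_apply]
    exact Finset.sum_congr rfl fun j _ => mul_comm _ _
  have hMy (y : Fin (n + 3) → ℝ) (i : Fin (n + 3)) :
      (M *ᵥ y) i = r i (diagonal (y ∘ i.succAbove)) 1 := by
    rw [hMq, hq, discBilin_cons_single, deleteRowCol_diagonal, deleteRowCol_one]
  have hquad (y z : Fin (n + 3) → ℝ) : y ⬝ᵥ (M *ᵥ z) = q (diagonal y) (diagonal z) := by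
    simp only [dotProduct, hMq]
    rw [diagonal_eq_sum_smul_single y, map_sum, LinearMap.sum_apply]
    simp only [map_smul, LinearMap.smul_apply, smul_eq_mul]
  have hMone : M *ᵥ 1 = p := by
    funext i
    rw [hMy]
    rfl
  rw [← hquad]
  refine neg_on_rowSum_orthogonal (p := p) ?_ ?_ hp ?_ ?_ hx ?_
  · ext i j
    exact discBilin_comm _ _ _
  · intro i j hij
    obtain ⟨j, rfl⟩ := Fin.exists_succAbove_eq hij.symm
    change 0 ≤ q _ _
    rw [hq, discBilin_cons_single, deleteRowCol_single, deleteRowCol_one, discBilin_apply,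
      discSum_cons_single]
    refine (discSum_pos fun k => posDef_deleteRowCol j ?_).le
    exact Fin.cases PosDef.one (hRi i) k
  · intro i
    rw [← hMone]
    simp [mulVec, dotProduct]
  · intro y hy
    rw [hquad, hq, discBilin_cons_one]
    have hlt (i : Fin (n + 3)) (hi : ∀ c : ℝ, diagonal (y ∘ i.succAbove) ≠ c • 1) :
        r i (deleteRowCol i (diagonal y)) (deleteRowCol i (diagonal y)) <
          (M *ᵥ y) i ^ 2 / p i := by
      rw [deleteRowCol_diagonal, lt_div_iff₀ (hp i), hMy]
      exact (ih _ (hRi i)).mul_lt_sq (hRi i) PosDef.one (isSymm_diagonal _) hi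
    refine Finset.sum_lt_sum (fun i _ => ?_) ?_
    · by_cases hi : ∀ c : ℝ, diagonal (y ∘ i.succAbove) ≠ c • 1
      · exact (hlt i hi).le
      · push Not at hi
        obtain ⟨c, hc⟩ := hi
        rw [deleteRowCol_diagonal, le_div_iff₀ (hp i), hMy, hc]
        exact (discBilin_smul_self _ c 1).ge
    · obtain ⟨a, ha⟩ := Function.ne_iff.1 (hy (y 0))
      obtain ⟨i, hia, hi0⟩ : ∃ i : Fin (n + 3), a ≠ i ∧ 0 ≠ i := by
        obtain ⟨i, hi⟩ := Finset.exists_mem_notMem_of_card_lt_card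
          (s := {a, 0}) (t := (Finset.univ : Finset (Fin (n + 3))))
          (Finset.card_le_two.trans_lt (by simp))
        refine ⟨i, ?_, ?_⟩ <;> rintro rfl <;> simp at hi
      refine ⟨i, Finset.mem_univ _, hlt i fun c hc => ha ?_⟩
      have key (j : Fin (n + 3)) (hj : j ≠ i) : y j = c := by
        obtain ⟨j, rfl⟩ := Fin.exists_succAbove_eq hj
        simpa using congrFun (congrFun hc j) j
      exact (key a hia).trans (key 0 hi0).symm
  · rw [← hMone, hquad, ← hx1]
    congr 1

theorem discBilin_neg_of_congr {n : ℕ} {C : Fin n → Matrix (Fin (n + 2)) (Fin (n + 2)) ℝ}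
    {A B T : Matrix (Fin (n + 2)) (Fin (n + 2)) ℝ}
    (h : discBilin (fun k => Tᵀ * C k * T) (Tᵀ * A * T) (Tᵀ * B * T) = 0 →
      discBilin (fun k => Tᵀ * C k * T) (Tᵀ * A * T) (Tᵀ * A * T) < 0)
    (hAB : discBilin C A B = 0) : discBilin C A A < 0 := by
  rw [discBilin_congr, discBilin_congr, hAB] at h
  exact neg_of_mul_neg_right (h (by simp)) (sq_nonneg _)

theorem ne_zero_of_transpose_mul_mul_eq_diagonal {m : Type*} [Fintype m] [DecidableEq m]
    {A T : Matrix m m ℝ} {x : m → ℝ} (hT : T.det ≠ 0) (hA : A ≠ 0)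
    (hx : Tᵀ * A * T = diagonal x) : x ≠ 0 := by
  rintro rfl
  have hu : IsUnit T := (isUnit_iff_isUnit_det T).2 hT.isUnit
  have hu' : IsUnit Tᵀ := (isUnit_iff_isUnit_det _).2 (by rw [det_transpose]; exact hT.isUnit)
  rw [show diagonal (0 : m → ℝ) = 0 from diagonal_zero, hu.mul_left_eq_zero, hu'.mul_right_eq_zero] at hx
  exact hA hx

theorem discBilin_two_diagonal (C : Fin 0 → Matrix (Fin 2) (Fin 2) ℝ) (x y : Fin 2 → ℝ) :
    discBilin C (diagonal x) (diagonal y) = x 0 * y 1 + x 1 * y 0 := by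
  rw [discBilin_apply, discSum_cons_diagonal]
  simp [discSum, deleteRowCol, Fin.sum_univ_two]

/-- **Alexandrov's inequality** for mixed discriminants, as negative definiteness on the orthogonal
complement of a positive definite matrix. -/
theorem negOnOrthogonal_of_posDef {n : ℕ} {C : Fin n → Matrix (Fin (n + 2)) (Fin (n + 2)) ℝ}
    (hC : ∀ k, (C k).PosDef) {B : Matrix (Fin (n + 2)) (Fin (n + 2)) ℝ} (hB : B.PosDef) :
    NegOnOrthogonal C B := by
  induction n with
  | zero =>
    intro A hA hA0
    obtain ⟨T, x, hT, hT1, hTA⟩ := exists_congr_one_diagonal hA hB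
    have hx := ne_zero_of_transpose_mul_mul_eq_diagonal hT hA0 hTA
    refine discBilin_neg_of_congr (T := T) ?_
    rw [hT1, hTA, ← diagonal_one, discBilin_two_diagonal, discBilin_two_diagonal]
    intro h
    have h1 : x 1 = -x 0 := by linarith
    have h0 : x 0 ≠ 0 := fun h0 => hx (by
      funext i
      fin_cases i <;> simp [h0, h1])
    rw [h1]
    nlinarith [sq_pos_of_ne_zero h0]
  | succ n ih =>
    refine neg_on_orthogonal_of_neg_on_orthogonal (discBilin C) (discBilin_comm C)
      (symmSubmodule _) (e := C 0) hB.mem_symmSubmodule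
      (discBilin_pos hC hB hB) (discBilin_pos hC hB (hC 0)).ne' ?_
    intro A hA hA0
    obtain ⟨T, x, hT, hT1, hTA⟩ := exists_congr_one_diagonal hA (hC 0)
    refine discBilin_neg_of_congr (T := T) ?_
    have hcons : (fun k => Tᵀ * C k * T) = Fin.cons 1 fun k : Fin n => Tᵀ * C k.succ * T := by
      funext k
      refine Fin.cases ?_ (fun k => ?_) k
      · simpa using hT1
      · simp
    rw [hcons, hT1, hTA]
    refine negOnOrthogonal_cons_one_diagonal (fun C hC => ih hC PosDef.one)
      (fun k => posDef_transpose_mul_mul (hC _) hT) ?_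
    exact ne_zero_of_transpose_mul_mul_eq_diagonal hT hA0 hTA

theorem mixedDisc2_eq_discBilin {n : ℕ} (A B : Matrix (Fin (n + 2)) (Fin (n + 2)) ℝ)
    (C : Fin (n + 2) → Matrix (Fin (n + 2)) (Fin (n + 2)) ℝ) :
    mixedDisc2 A B C =
      ((n + 2).factorial : ℝ)⁻¹ * discBilin (fun k => C k.succ.succ) A B := by
  have h : (fun k => if k = 0 then A else if k = 1 then B else C k) =
      (Fin.cons A (Fin.cons B fun k => C k.succ.succ) :
        Fin (n + 2) → Matrix (Fin (n + 2)) (Fin (n + 2)) ℝ) := by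
    funext k
    refine Fin.cases ?_ (fun k => Fin.cases ?_ (fun k => ?_) k) k
    · simp
    · simp
    · simp [Fin.ext_iff]
  rw [mixedDisc2, h]
  rfl

end MixedDiscriminant

/-- Equality case of Alexandrov's mixed discriminant inequality: for `A`
symmetric and `B, C₃, …, Cₙ` symmetric positive definite, equality
`Q(A, B, C₃, …, Cₙ)² = Q(A, A, C₃, …, Cₙ) · Q(B, B, C₃, …, Cₙ)` holds iff
`A = c • B` for some real `c`. -/
theorem stmt8 {n : ℕ} (A B : Matrix (Fin (n + 2)) (Fin (n + 2)) ℝ)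
    (C : Fin (n + 2) → Matrix (Fin (n + 2)) (Fin (n + 2)) ℝ)
    (hA : A.IsSymm) (hB : B.PosDef)
    (hC : ∀ k, k ≠ 0 → k ≠ 1 → (C k).PosDef) :
    (mixedDisc2 A B C) ^ 2 = mixedDisc2 A A C * mixedDisc2 B B C ↔
      ∃ c : ℝ, A = c • B := by
  have hC' (k : Fin n) : (C k.succ.succ).PosDef :=
    hC _ (Fin.succ_ne_zero _) fun h => Fin.succ_ne_zero k (Fin.succ_injective _ h)
  have hfac : ((n + 2).factorial : ℝ)⁻¹ ≠ 0 := by positivity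
  have hiff : mixedDisc2 A B C ^ 2 = mixedDisc2 A A C * mixedDisc2 B B C ↔
      discBilin (fun k => C k.succ.succ) A B ^ 2 =
        discBilin (fun k => C k.succ.succ) A A * discBilin (fun k => C k.succ.succ) B B := by
    simp only [mixedDisc2_eq_discBilin]
    rw [mul_pow, mul_mul_mul_comm, ← sq, mul_right_inj' (pow_ne_zero 2 hfac)]
  rw [hiff]
  constructor
  · intro h
    by_contra! hne
    exact ((negOnOrthogonal_of_posDef hC' hB).mul_lt_sq hC' hB hA hne).ne' h
  · rintro ⟨c, rfl⟩
    exact discBilin_smul_self _ c B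
end

section
/- Let n ≥ 2, let v ∈ ℝⁿ, let Q : {1,…,n}³ → ℝ be totally symmetric (invariant under all permutations of its three indices), and let A₂, …, Aₙ be symmetric real n×n matrices. Then Σ_{k=2}^{n} Σ_{σ,τ ∈ Sₙ} sgn(σ)·sgn(τ) · v_{σ(1)} · ( Σ_{m=1}^{n} Q(σ(k), τ(1), m) · (A_k)_{m, τ(k)} ) · ∏_{l=2, l≠k}^{n} (A_l)_{σ(l), τ(l)} = Σ_{σ,τ ∈ Sₙ} sgn(σ)·sgn(τ) · ( v_{σ(1)} · Σ_{m=1}^{n} Q(m, τ(1), m) − Σ_{m=1}^{n} v_m · Q(m, τ(1), σ(1)) ) · ∏_{l=2}^{n} (A_l)_{σ(l), τ(l)}, where Sₙ is the symmetric group on {1, …, n}. -/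
/-- Laplace-type expansion of a determinant with one column replaced. -/
theorem det_updateCol_eq_sum_perm {ι R : Type*} [Fintype ι] [DecidableEq ι] [CommRing R]
    (C : Matrix ι ι R) (k : ι) (b : ι → R) :
    (C.updateCol k b).det = ∑ σ : Equiv.Perm ι, ((Equiv.Perm.sign σ : ℤ) : R) *
      (b (σ k) * ∏ l ∈ Finset.univ.filter (fun l => l ≠ k), C (σ l) l) := by
  rw [Matrix.det_apply']
  refine Finset.sum_congr rfl fun σ _ => ?_
  rw [← Finset.mul_prod_erase Finset.univ _ (Finset.mem_univ k), Matrix.updateCol_self,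
    Finset.filter_ne']
  congr 2
  exact Finset.prod_congr rfl fun l hl => by
    rw [Matrix.updateCol_ne (Finset.ne_of_mem_erase hl)]

/-- Applying `M` to each column in turn and summing the determinants yields
`M.trace * C.det`. -/
theorem sum_det_updateCol_mulVec {ι R : Type*} [Fintype ι] [DecidableEq ι] [CommRing R]
    (M C : Matrix ι ι R) :
    ∑ k, (C.updateCol k (M.mulVec (C.col k))).det = M.trace * C.det := by
  have h (k : ι) : (C.updateCol k (M.mulVec (C.col k))).det = (C.adjugate * (M * C)) k k := by
    rw [← Matrix.cramer_apply, Matrix.cramer_eq_adjugate_mulVec]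
    rfl
  calc _ = (C.adjugate * (M * C)).trace := Finset.sum_congr rfl fun k _ => h k
    _ = (M * (C * C.adjugate)).trace := by rw [Matrix.trace_mul_comm, Matrix.mul_assoc]
    _ = _ := by
      rw [Matrix.mul_adjugate, Matrix.mul_smul, Matrix.mul_one, Matrix.trace_smul, smul_eq_mul,
        mul_comm]

/-- The combinatorial core of the divergence identity for mixed-discriminant
cofactors (Lemma 3.5 of the paper). Indices `1, …, n` of the paper are
represented by `Fin (n + 2)`, with the paper's index `1` corresponding to `0`
and the paper's indices `2, …, n` corresponding to the nonzero indices. -/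
theorem stmt9 {n : ℕ} (v : Fin (n + 2) → ℝ)
    (Q : Fin (n + 2) → Fin (n + 2) → Fin (n + 2) → ℝ)
    (hQ1 : ∀ i j k, Q i j k = Q j i k) (hQ2 : ∀ i j k, Q i j k = Q i k j)
    (A : Fin (n + 2) → Matrix (Fin (n + 2)) (Fin (n + 2)) ℝ)
    (hA : ∀ k, k ≠ 0 → (A k).IsSymm) :
    ∑ k ∈ Finset.univ.filter (fun k : Fin (n + 2) => k ≠ 0),
      ∑ σ : Equiv.Perm (Fin (n + 2)), ∑ τ : Equiv.Perm (Fin (n + 2)),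
        ((Equiv.Perm.sign σ : ℤ) : ℝ) * ((Equiv.Perm.sign τ : ℤ) : ℝ) *
          v (σ 0) * (∑ m : Fin (n + 2), Q (σ k) (τ 0) m * (A k) m (τ k)) *
          ∏ l ∈ Finset.univ.filter (fun l : Fin (n + 2) => l ≠ 0 ∧ l ≠ k),
            (A l) (σ l) (τ l)
    =
    ∑ σ : Equiv.Perm (Fin (n + 2)), ∑ τ : Equiv.Perm (Fin (n + 2)),
      ((Equiv.Perm.sign σ : ℤ) : ℝ) * ((Equiv.Perm.sign τ : ℤ) : ℝ) *
        (v (σ 0) * (∑ m : Fin (n + 2), Q m (τ 0) m)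
          - ∑ m : Fin (n + 2), v m * Q m (τ 0) (σ 0)) *
        ∏ l ∈ Finset.univ.filter (fun l : Fin (n + 2) => l ≠ 0),
          (A l) (σ l) (τ l) := by
  rw [Finset.sum_congr rfl fun k _ => Finset.sum_comm, Finset.sum_comm]
  conv_rhs => rw [Finset.sum_comm]
  refine Finset.sum_congr rfl fun τ _ => ?_
  let M : Matrix (Fin (n + 2)) (Fin (n + 2)) ℝ := Matrix.of fun i m => Q i (τ 0) m
  let C : Matrix (Fin (n + 2)) (Fin (n + 2)) ℝ :=
    Matrix.of fun i l => if l = 0 then v i else A l i (τ l)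
  have hC0 (i) : C i 0 = v i := by simp [C]
  have hC (i l) (hl : l ≠ 0) : C i l = A l i (τ l) := by simp [C, hl]
  have hprod (σ : Equiv.Perm (Fin (n + 2))) :
      ∏ l ∈ Finset.univ.filter (fun l => l ≠ 0), C (σ l) l =
        ∏ l ∈ Finset.univ.filter (fun l => l ≠ 0), A l (σ l) (τ l) :=
    Finset.prod_congr rfl fun l hl => hC _ _ (Finset.mem_filter.1 hl).2
  have hMv (i) : M.mulVec (C.col 0) i = ∑ m, v m * Q m (τ 0) i := by
    rw [Matrix.mulVec, dotProduct]
    refine Finset.sum_congr rfl fun m _ => ?_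
    change Q i (τ 0) m * C m 0 = _
    rw [hC0, mul_comm, hQ1 i, hQ2 (τ 0) i m, hQ1 (τ 0) m i]
  have hcol (k : Fin (n + 2)) (hk : k ≠ 0) :
      (C.updateCol k (M.mulVec (C.col k))).det = ∑ σ : Equiv.Perm (Fin (n + 2)),
        ((Equiv.Perm.sign σ : ℤ) : ℝ) * v (σ 0) *
          (∑ m : Fin (n + 2), Q (σ k) (τ 0) m * (A k) m (τ k)) *
          ∏ l ∈ Finset.univ.filter (fun l : Fin (n + 2) => l ≠ 0 ∧ l ≠ k),
            (A l) (σ l) (τ l) := by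
    rw [det_updateCol_eq_sum_perm]
    refine Finset.sum_congr rfl fun σ _ => ?_
    have hmul : M.mulVec (C.col k) (σ k) = ∑ m, Q (σ k) (τ 0) m * A k m (τ k) := by
      rw [Matrix.mulVec, dotProduct]
      exact Finset.sum_congr rfl fun m _ => congrArg (Q (σ k) (τ 0) m * ·) (hC m k hk)
    have hsplit : ∏ l ∈ Finset.univ.filter (fun l => l ≠ k), C (σ l) l = v (σ 0) *
        ∏ l ∈ Finset.univ.filter (fun l => l ≠ 0 ∧ l ≠ k), A l (σ l) (τ l) := by
      have hset : (Finset.univ.filter (fun l : Fin (n + 2) => l ≠ k)).erase 0 =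
          Finset.univ.filter (fun l => l ≠ 0 ∧ l ≠ k) := by
        ext l
        simp
      rw [← Finset.mul_prod_erase _ _ (Finset.mem_filter.2 ⟨Finset.mem_univ 0, hk.symm⟩), hset,
        hC0]
      exact congrArg _ (Finset.prod_congr rfl fun l hl => hC _ _ (Finset.mem_filter.1 hl).2.1)
    rw [hmul, hsplit]
    ring
  have hdet : C.det = ∑ σ : Equiv.Perm (Fin (n + 2)), ((Equiv.Perm.sign σ : ℤ) : ℝ) *
      (v (σ 0) * ∏ l ∈ Finset.univ.filter (fun l => l ≠ 0), A l (σ l) (τ l)) := by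
    conv_lhs => rw [← Matrix.updateCol_eq_self C 0, det_updateCol_eq_sum_perm]
    simp only [hprod, hC0]
  have key := sum_det_updateCol_mulVec M C
  rw [← Finset.add_sum_erase _ _ (Finset.mem_univ (0 : Fin (n + 2))), ← Finset.filter_ne',
    Finset.sum_congr rfl fun k hk => hcol k (Finset.mem_filter.1 hk).2,
    det_updateCol_eq_sum_perm, hdet] at key
  simp only [hprod, hMv] at key
  have htr : M.trace = ∑ m, Q m (τ 0) m := rfl
  rw [htr, ← eq_sub_iff_add_eq'] at key
  refine Eq.trans ?_ ((congrArg (((Equiv.Perm.sign τ : ℤ) : ℝ) * ·) key).trans ?_)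
  · rw [Finset.mul_sum]
    refine Finset.sum_congr rfl fun k _ => ?_
    rw [Finset.mul_sum]
    exact Finset.sum_congr rfl fun σ _ => by ring
  · rw [Finset.mul_sum, ← Finset.sum_sub_distrib, Finset.mul_sum]
    exact Finset.sum_congr rfl fun σ _ => by ring
end

section
/- Let n ≥ 3, let v ∈ ℝⁿ, let Q : {1,…,n}³ → ℝ be totally symmetric, and let A₂, …, Aₙ be symmetric real n×n matrices. For distinct indices k, l ∈ {2, …, n} define B_{l,k} := Σ_{σ,τ ∈ Sₙ} sgn(σ)·sgn(τ) · v_{σ(1)} · Q(σ(k), τ(1), σ(l)) · (A_k)_{σ(l), τ(k)} · ∏_{p=2, p≠k}^{n} (A_p)_{σ(p), τ(p)}. Then B_{l,k} = −B_{k,l} for all distinct k, l ∈ {2, …, n}. -/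
/-- The quantity `B_{l,k}` from Lemma 3.5 of the paper. Indices `1, …, n` of
the paper are represented by `Fin (n + 3)`, with the paper's index `1`
corresponding to `0` and the paper's indices `2, …, n` corresponding to the
nonzero indices. -/
noncomputable def Bterm {N : ℕ} (v : Fin (N + 1) → ℝ)
    (Q : Fin (N + 1) → Fin (N + 1) → Fin (N + 1) → ℝ)
    (A : Fin (N + 1) → Matrix (Fin (N + 1)) (Fin (N + 1)) ℝ)
    (l k : Fin (N + 1)) : ℝ :=
  ∑ σ : Equiv.Perm (Fin (N + 1)), ∑ τ : Equiv.Perm (Fin (N + 1)),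
    ((Equiv.Perm.sign σ : ℤ) : ℝ) * ((Equiv.Perm.sign τ : ℤ) : ℝ) *
      v (σ 0) * Q (σ k) (τ 0) (σ l) * (A k) (σ l) (τ k) *
      ∏ p ∈ Finset.univ.filter (fun p : Fin (N + 1) => p ≠ 0 ∧ p ≠ k),
        (A p) (σ p) (τ p)

/-- The product over `p ≠ 0, k` splits off its factor at `l`. -/
theorem prod_filter_ne_zero_ne {N : ℕ} (f : Fin (N + 1) → ℝ) {k l : Fin (N + 1)}
    (hl : l ≠ 0) (hkl : k ≠ l) :
    ∏ p ∈ Finset.univ.filter (fun p : Fin (N + 1) => p ≠ 0 ∧ p ≠ k), f p =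
      f l * ∏ p ∈ Finset.univ.filter (fun p : Fin (N + 1) => p ≠ 0 ∧ p ≠ k ∧ p ≠ l), f p := by
  rw [← Finset.prod_insert (by simp)]
  congr 1
  ext p
  simp only [Finset.mem_filter, Finset.mem_univ, true_and, Finset.mem_insert]
  by_cases hp : p = l
  · subst hp
    simp [hl, hkl.symm]
  · simp [hp]

/-- Antisymmetry `B_{l,k} = −B_{k,l}` of the off-diagonal terms in the proof of
the divergence identity for mixed-discriminant cofactors. -/
theorem stmt10 {n : ℕ} (v : Fin (n + 3) → ℝ)
    (Q : Fin (n + 3) → Fin (n + 3) → Fin (n + 3) → ℝ)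
    (hQ1 : ∀ i j k, Q i j k = Q j i k) (hQ2 : ∀ i j k, Q i j k = Q i k j)
    (A : Fin (n + 3) → Matrix (Fin (n + 3)) (Fin (n + 3)) ℝ)
    (hA : ∀ p, p ≠ 0 → (A p).IsSymm)
    (k l : Fin (n + 3)) (hk : k ≠ 0) (hl : l ≠ 0) (hkl : k ≠ l) :
    Bterm v Q A l k = - Bterm v Q A k l := by
  unfold Bterm
  rw [← Equiv.sum_comp (Equiv.mulRight (Equiv.swap k l))
    (fun σ : Equiv.Perm (Fin (n + 3)) => ∑ τ : Equiv.Perm (Fin (n + 3)),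
      ((Equiv.Perm.sign σ : ℤ) : ℝ) * ((Equiv.Perm.sign τ : ℤ) : ℝ) *
        v (σ 0) * Q (σ l) (τ 0) (σ k) * (A l) (σ k) (τ l) *
        ∏ p ∈ Finset.univ.filter (fun p : Fin (n + 3) => p ≠ 0 ∧ p ≠ l), (A p) (σ p) (τ p)),
    ← Finset.sum_neg_distrib]
  refine Finset.sum_congr rfl fun σ _ => ?_
  rw [← Finset.sum_neg_distrib]
  refine Finset.sum_congr rfl fun τ _ => ?_
  rw [prod_filter_ne_zero_ne _ hl hkl, prod_filter_ne_zero_ne _ hk hkl.symm]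
  have hprod : ∏ p ∈ Finset.univ.filter (fun p : Fin (n + 3) => p ≠ 0 ∧ p ≠ l ∧ p ≠ k),
      (A p) (σ (Equiv.swap k l p)) (τ p) =
      ∏ p ∈ Finset.univ.filter (fun p : Fin (n + 3) => p ≠ 0 ∧ p ≠ k ∧ p ≠ l),
        (A p) (σ p) (τ p) := by
    refine Finset.prod_congr (by ext p; simp only [Finset.mem_filter]; tauto) fun p hp => ?_
    simp only [Finset.mem_filter] at hp
    rw [Equiv.swap_apply_of_ne_of_ne hp.2.2.1 hp.2.2.2]
  simp only [Equiv.coe_mulRight, Equiv.Perm.sign_mul, Equiv.Perm.sign_swap hkl,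
    Equiv.Perm.mul_apply, Equiv.swap_apply_left, Equiv.swap_apply_right,
    Equiv.swap_apply_of_ne_of_ne hk.symm hl.symm]
  erw [hprod]
  push_cast
  ring
end
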